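/- arXiv:0906.3421 — 5 statements merged into one kernel-verified Lean document; each statement's English description precedes it below -/
import Mathlib

section
/- Let (x_n)_{n∈ℤ} be a (1,4)-sequence. Then for every integer n ≥ 0, x_{2n} = Σ_{q,ℓ,r,s,m ≥ 0} x_0^{1+4(q+ℓ)−2n−4(r+s)}·x_1^{m−q−ℓ}·C(n−q−ℓ; q−r, r)·C(q+ℓ−1; ℓ−s, s)·C(n+2r+s−2q−ℓ, m), where the exponents are integers (integer powers of the positive reals x_0, x_1) and the binomial and multinomial conventions below are used (only finitely many terms are nonzero). -/
/-- Binomial convention: C(a,b) = a!/(b!(a−b)!) if 0 ≤ b ≤ a, C(−1,0) = 1,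
and C(a,b) = 0 otherwise. -/
def intChoose (a b : ℤ) : ℤ :=
  if 0 ≤ b ∧ b ≤ a then Nat.choose a.toNat b.toNat
  else if a = -1 ∧ b = 0 then 1 else 0

/-- Multinomial convention: C(n; m_1,…,m_k) = n!/(m_1!⋯m_k!(n−Σm_j)!) if all
m_j ≥ 0 and Σ m_j ≤ n, C(−1; 0,…,0) = 1, and 0 otherwise. -/
def intMultinomial (n : ℤ) (ms : List ℤ) : ℤ :=
  if (∀ a ∈ ms, 0 ≤ a) ∧ ms.sum ≤ n then
    (Nat.factorial n.toNat /
      ((ms.map fun a => Nat.factorial a.toNat).prod *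
        Nat.factorial (n - ms.sum).toNat) : ℕ)
  else if n = -1 ∧ ∀ a ∈ ms, a = 0 then 1 else 0

lemma mult_nat (N a b : ℕ) :
    intMultinomial (N : ℤ) [(a : ℤ) - b, (b : ℤ)] = (N.choose a * a.choose b : ℕ) := by
  unfold intMultinomial
  by_cases hb : b ≤ a
  · by_cases ha : a ≤ N
    · rw [if_pos (by simp; omega)]
      obtain ⟨c, rfl⟩ := Nat.exists_eq_add_of_le hb
      obtain ⟨d, rfl⟩ := Nat.exists_eq_add_of_le ha
      congr 1
      have e1 : (((b + c : ℕ) : ℤ) - b).toNat = c := by omega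
      have e2 : (((b + c + d : ℕ) : ℤ) - ([((b + c : ℕ) : ℤ) - b, (b : ℤ)]).sum).toNat = d := by
        simp; omega
      rw [e2]
      simp only [List.map_cons, List.map_nil, List.prod_cons, List.prod_nil, e1, Int.toNat_natCast,
        mul_one]
      apply Nat.div_eq_of_eq_mul_left (by positivity)
      have h1 := Nat.add_choose_mul_factorial_mul_factorial (b + c) d
      have h2 := Nat.add_choose_mul_factorial_mul_factorial b c
      rw [← h1, ← h2, Nat.choose_symm_add (a := b + c) (b := d),
        Nat.choose_symm_add (a := b) (b := c)]
      ring
    · rw [if_neg (by simp; omega), if_neg (by omega), Nat.choose_eq_zero_of_lt (by omega)]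
      simp
  · rw [if_neg (by simp; omega), if_neg (by omega), Nat.choose_eq_zero_of_lt (n := a) (by omega)]
    simp

lemma choose_nat (N m : ℕ) : intChoose (N : ℤ) (m : ℤ) = (N.choose m : ℕ) := by
  unfold intChoose
  by_cases h : m ≤ N
  · rw [if_pos (by omega)]; simp
  · rw [if_neg (by omega), if_neg (by omega), Nat.choose_eq_zero_of_lt (by omega)]; simp

def PP (n q l : ℕ) : ℕ := (n - q - l).choose q * (q + l - 1).choose l

lemma PP_zero (n q l : ℕ) (h : n < 2 * q + l) : PP n q l = 0 := by
  unfold PP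
  rcases Nat.eq_zero_or_pos q with rfl | hq
  · rw [Nat.choose_eq_zero_of_lt (n := 0 + l - 1) (by omega)]; simp
  · rw [Nat.choose_eq_zero_of_lt (n := n - q - l) (by omega)]; simp

lemma mult2 (q l s : ℕ) : intMultinomial ((q : ℤ) + l - 1) [(l : ℤ) - s, (s : ℤ)] =
    ((q + l - 1).choose l * l.choose s : ℕ) := by
  rcases Nat.eq_zero_or_pos (q + l) with h | h
  · obtain ⟨rfl, rfl⟩ : q = 0 ∧ l = 0 := by omega
    rcases Nat.eq_zero_or_pos s with rfl | hs
    · simp [intMultinomial]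
    · rw [Nat.choose_eq_zero_of_lt (n := 0) (k := s) hs]
      unfold intMultinomial
      rw [if_neg (by simp), if_neg (by simp; omega)]
      simp
  · rw [← mult_nat]
    congr 1
    omega

lemma coef (n q l r s : ℕ) : intMultinomial ((n : ℤ) - q - l) [(q : ℤ) - r, (r : ℤ)] *
          intMultinomial ((q : ℤ) + l - 1) [(l : ℤ) - s, (s : ℤ)] =
    (PP n q l * q.choose r * l.choose s : ℕ) := by
  rw [mult2]
  by_cases h : q + l ≤ n
  · have : (n : ℤ) - q - l = ((n - q - l : ℕ) : ℤ) := by omega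
    rw [this, mult_nat]
    unfold PP
    push_cast
    ring
  · rw [PP_zero n q l (by omega)]
    rcases Nat.eq_zero_or_pos q with rfl | hq
    · rw [Nat.choose_eq_zero_of_lt (n := 0 + l - 1) (by omega)]; simp
    · have : intMultinomial ((n : ℤ) - q - l) [(q : ℤ) - r, (r : ℤ)] = 0 := by
        unfold intMultinomial
        rw [if_neg (by simp; omega), if_neg (by simp; omega)]
      rw [this]; simp

lemma fin_choose (K w : ℝ) (N : ℕ) :
    ∑ᶠ s : ℕ, K * ((N.choose s : ℝ) * w ^ s) = K * (1 + w) ^ N := by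
  rw [finsum_eq_sum_of_support_subset (s := Finset.range (N + 1))]
  · rw [← Finset.mul_sum, add_comm 1 w, add_pow]
    congr 1
    apply Finset.sum_congr rfl
    intros
    simp [mul_comm]
  · intro s hs
    by_contra h
    apply hs
    simp only [Finset.coe_range, Set.mem_Iio, not_lt] at h
    simp [Nat.choose_eq_zero_of_lt (show N < s by omega)]

lemma q14_inner (a b : ℝ) (ha : 0 < a) (hb : 0 < b) (n q l : ℕ) :
    ∑ᶠ (r : ℕ), ∑ᶠ (s : ℕ), ∑ᶠ (m : ℕ),
        a ^ (1 + 4 * ((q : ℤ) + (l : ℤ)) - 2 * (n : ℤ) - 4 * ((r : ℤ) + (s : ℤ))) *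
        b ^ ((m : ℤ) - (q : ℤ) - (l : ℤ)) *
        ((intMultinomial ((n : ℤ) - q - l) [(q : ℤ) - r, (r : ℤ)] *
          intMultinomial ((q : ℤ) + l - 1) [(l : ℤ) - s, (s : ℤ)] *
          intChoose ((n : ℤ) + 2 * r + s - 2 * q - l) (m : ℤ) : ℤ) : ℝ) =
    a * ((1 + b) / a ^ 2) ^ n * (PP n q l * ((a ^ 4 + (1 + b) ^ 2) / (b * (1 + b) ^ 2)) ^ q *
      ((a ^ 4 + (1 + b)) / (b * (1 + b))) ^ l) := by
  simp only [coef]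
  by_cases h : n < 2 * q + l
  · simp [PP_zero n q l h]
  obtain ⟨k, rfl⟩ := Nat.exists_eq_add_of_le (not_lt.mp h)
  generalize PP (2 * q + l + k) q l = P
  have hb1 : 0 < 1 + b := by positivity
  set K : ℝ := P * (a ^ (1 - 2 * (l : ℤ) - 2 * k + 4 * l) * b ^ (-(q : ℤ) - l) * (1 + b) ^ k) with hK
  have key : ∀ r s m : ℕ,
      a ^ (1 + 4 * ((q : ℤ) + (l : ℤ)) - 2 * ((2 * q + l + k : ℕ) : ℤ) - 4 * ((r : ℤ) + (s : ℤ))) *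
        b ^ ((m : ℤ) - (q : ℤ) - (l : ℤ)) *
        ((((P * q.choose r * l.choose s : ℕ) : ℤ) *
          intChoose (((2 * q + l + k : ℕ) : ℤ) + 2 * r + s - 2 * q - l) (m : ℤ) : ℤ) : ℝ) =
      (K * (q.choose r * (((1 + b) ^ 2 / a ^ 4) ^ r)) * (l.choose s * ((1 + b) / a ^ 4) ^ s) /
        (1 + b) ^ (k + 2 * r + s)) * (((k + 2 * r + s).choose m : ℝ) * b ^ m) := by
    intro r s m
    have e : ((2 * q + l + k : ℕ) : ℤ) + 2 * r + s - 2 * q - l = ((k + 2 * r + s : ℕ) : ℤ) := by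
      push_cast; ring
    have e1 : 1 + 4 * ((q : ℤ) + (l : ℤ)) - 2 * ((2 * q + l + k : ℕ) : ℤ) - 4 * ((r : ℤ) + (s : ℤ))
      = (1 - 2 * (l : ℤ) - 2 * k + 4 * l) - ((4 * r + 4 * s : ℕ) : ℤ) := by
      push_cast; ring
    have e2 : (m : ℤ) - q - l = (-(q : ℤ) - l) + (m : ℕ) := by ring
    rw [e, choose_nat, e1, e2, zpow_sub₀ ha.ne', zpow_add₀ hb.ne', zpow_natCast, zpow_natCast, hK]
    generalize a ^ (1 - 2 * (l : ℤ) - 2 * k + 4 * l) = A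
    generalize b ^ (-(q : ℤ) - l) = B
    push_cast
    simp only [div_pow, ← pow_mul, pow_add]
    field_simp
  simp only [key]
  simp only [fin_choose]
  have key2 : ∀ r s : ℕ, 
      (K * (q.choose r * (((1 + b) ^ 2 / a ^ 4) ^ r)) * (l.choose s * ((1 + b) / a ^ 4) ^ s) /
        (1 + b) ^ (k + 2 * r + s)) * (1 + b) ^ (k + 2 * r + s) = 
      (K * (q.choose r * (((1 + b) ^ 2 / a ^ 4) ^ r))) * (l.choose s * ((1 + b) / a ^ 4) ^ s) := by
    intro r s
    field_simp
  simp only [key2, fin_choose]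
  have key3 : ∀ r : ℕ, K * (q.choose r * (((1 + b) ^ 2 / a ^ 4) ^ r)) * (1 + (1 + b) / a ^ 4) ^ l
    = (K * (1 + (1 + b) / a ^ 4) ^ l) * (q.choose r * (((1 + b) ^ 2 / a ^ 4) ^ r)) := by
    intro r; ring
  simp only [key3, fin_choose]
  have e1 : (1 - 2 * (l : ℤ) - 2 * k + 4 * l) = ((1 + 2 * l : ℕ) : ℤ) - ((2 * k : ℕ) : ℤ) := by
    push_cast; ring
  have e2 : (-(q : ℤ) - l) = - ((q + l : ℕ) : ℤ) := by push_cast; ring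
  rw [hK, e1, e2, zpow_sub₀ ha.ne', zpow_neg, zpow_natCast, zpow_natCast, zpow_natCast]
  have f1 : 1 + (1 + b) / a ^ 4 = (a ^ 4 + (1 + b)) / a ^ 4 := by field_simp
  have f2 : 1 + (1 + b) ^ 2 / a ^ 4 = (a ^ 4 + (1 + b) ^ 2) / a ^ 4 := by field_simp
  rw [f1, f2]
  generalize a ^ 4 + (1 + b) ^ 2 = X
  generalize a ^ 4 + (1 + b) = Y
  generalize 1 + b = c at *
  simp only [div_pow, mul_pow, ← pow_mul, pow_add]
  field_simp
  ring

/-- The two-variable sum after summing out `r`, `s`, `m`. -/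
noncomputable def SS (Q L : ℝ) (n : ℕ) : ℝ :=
  ∑ᶠ (q : ℕ), ∑ᶠ (l : ℕ), (PP n q l : ℝ) * Q ^ q * L ^ l

lemma SS_eq (Q L : ℝ) (n M : ℕ) (hM : n < M) :
    SS Q L n = ∑ q ∈ Finset.range M, ∑ l ∈ Finset.range M, (PP n q l : ℝ) * Q ^ q * L ^ l := by
  unfold SS
  have h : ∀ q, ∑ᶠ (l : ℕ), (PP n q l : ℝ) * Q ^ q * L ^ l =
      ∑ l ∈ Finset.range M, (PP n q l : ℝ) * Q ^ q * L ^ l := by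
    intro q
    apply finsum_eq_sum_of_support_subset
    intro l hl
    by_contra h
    apply hl
    simp only [Finset.coe_range, Set.mem_Iio, not_lt] at h
    simp [PP_zero n q l (by omega)]
  simp only [h]
  apply finsum_eq_sum_of_support_subset
  intro q hq
  by_contra h
  apply hq
  simp only [Finset.coe_range, Set.mem_Iio, not_lt] at h
  apply Finset.sum_eq_zero
  intro l _
  simp [PP_zero n q l (by omega)]

lemma PP_rec (n q l : ℕ) : PP (n + 2) (q + 1) (l + 1) + PP n (q + 1) l =
    PP (n + 1) (q + 1) (l + 1) + PP (n + 1) (q + 1) l + PP n q (l + 1) := by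
  by_cases h : q + l ≤ n
  · obtain ⟨k, rfl⟩ := Nat.exists_eq_add_of_le h
    unfold PP
    have a1 : q + l + k + 2 - (q + 1) - (l + 1) = k := by omega
    have a2 : q + l + k - (q + 1) - l = k - 1 := by omega
    have a3 : q + l + k + 1 - (q + 1) - (l + 1) = k - 1 := by omega
    have a4 : q + l + k + 1 - (q + 1) - l = k := by omega
    have a5 : q + l + k - q - (l + 1) = k - 1 := by omega
    have a6 : q + 1 + (l + 1) - 1 = q + l + 1 := by omega
    have a7 : q + 1 + l - 1 = q + l := by omega
    have a8 : q + (l + 1) - 1 = q + l := by omega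
    rw [a1, a2, a3, a4, a5, a6, a7, a8, Nat.choose_succ_succ (q + l) l]
    rcases k with _ | k
    · rcases q with _ | q <;> simp
    · rw [Nat.add_sub_cancel, Nat.choose_succ_succ k q]
      ring
  · rw [PP_zero, PP_zero, PP_zero, PP_zero, PP_zero] <;> omega

lemma PP_rec0 (n q : ℕ) : PP (n + 2) (q + 1) 0 =
    PP (n + 1) (q + 1) 0 + PP n q 0 := by
  unfold PP
  simp only [Nat.choose_zero_right, mul_one, Nat.sub_zero]
  by_cases h : q ≤ n
  · have a1 : n + 2 - (q + 1) = (n - q) + 1 := by omega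
    have a2 : n + 1 - (q + 1) = n - q := by omega
    rw [a1, a2, Nat.choose_succ_succ]; ring
  · rw [Nat.choose_eq_zero_of_lt, Nat.choose_eq_zero_of_lt, Nat.choose_eq_zero_of_lt] <;> omega

lemma PP_00 (n : ℕ) : PP n 0 0 = 1 := by simp [PP]

lemma PP_0s (n l : ℕ) : PP n 0 (l + 1) = 0 := by simp [PP]

lemma SS_split (Q L : ℝ) (n M : ℕ) (hM : n < M) :
    SS Q L n = 1 + ∑ q ∈ Finset.range M, ((PP n (q + 1) 0 : ℝ) * Q ^ (q + 1) +
      ∑ l ∈ Finset.range M, (PP n (q + 1) (l + 1) : ℝ) * Q ^ (q + 1) * L ^ (l + 1)) := by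
  rw [SS_eq Q L n (M + 1) (by omega), Finset.sum_range_succ', Finset.sum_range_succ' _ M]
  simp only [PP_0s, PP_00, Finset.sum_range_succ' _ M]
  simp [add_comm]

lemma SS_splitL (Q L : ℝ) (n M : ℕ) (hM : n < M) :
    SS Q L n = 1 + ∑ q ∈ Finset.range M, ∑ l ∈ Finset.range M,
      (PP n (q + 1) l : ℝ) * Q ^ (q + 1) * L ^ l := by
  rw [SS_split Q L n M hM]
  congr 1
  apply Finset.sum_congr rfl
  intro q _
  have h := Finset.sum_range_succ (fun l => (PP n (q + 1) l : ℝ) * Q ^ (q + 1) * L ^ l) M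
  rw [PP_zero n (q + 1) M (by omega), Finset.sum_range_succ'] at h
  simp at h
  rw [← h]
  ring

lemma SS_splitQ (Q L : ℝ) (n M : ℕ) (hM : n < M) :
    SS Q L n = ∑ q ∈ Finset.range M, ((PP n q 0 : ℝ) * Q ^ q +
      ∑ l ∈ Finset.range M, (PP n q (l + 1) : ℝ) * Q ^ q * L ^ (l + 1)) := by
  rw [SS_eq Q L n M hM]
  apply Finset.sum_congr rfl
  intro q _
  have h := Finset.sum_range_succ (fun l => (PP n q l : ℝ) * Q ^ q * L ^ l) M
  rw [PP_zero n q M (by omega), Finset.sum_range_succ'] at h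
  simp at h
  rw [← h]
  ring

lemma SS_rec (Q L : ℝ) (n : ℕ) :
    SS Q L (n + 2) = (1 + L) * SS Q L (n + 1) + (Q - L) * SS Q L n := by
  have h1 := SS_split Q L (n + 2) (n + 3) (by omega)
  have h2 := SS_split Q L (n + 1) (n + 3) (by omega)
  have h3 := SS_splitL Q L (n + 1) (n + 3) (by omega)
  have h4 := SS_splitL Q L n (n + 3) (by omega)
  have h5 := SS_splitQ Q L n (n + 3) (by omega)
  have e : (1 + L) * SS Q L (n + 1) + (Q - L) * SS Q L n =
    SS Q L (n + 1) + L * SS Q L (n + 1) + Q * SS Q L n - L * SS Q L n := by ring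
  rw [e, h1]
  nth_rewrite 1 [h2]
  rw [h3]
  nth_rewrite 1 [h5]
  rw [h4]
  rw [← sub_eq_zero]
  have e2 : ∀ s1 s2 s3 s4 s5 : ℝ, 1 + s1 - (1 + s2 + L * (1 + s3) + Q * s5 - L * (1 + s4)) =
    s1 - (s2 + L * s3 + Q * s5 - L * s4) := by intros; ring
  rw [e2, sub_eq_zero]
  simp only [Finset.mul_sum, ← Finset.sum_add_distrib, ← Finset.sum_sub_distrib]
  apply Finset.sum_congr rfl
  intro q _
  rw [mul_add Q, Finset.mul_sum, PP_rec0]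
  have e3 : ∀ t1 t2 t3 t4 : ℝ, ∀ u1 u2 : ℝ, u1 + t1 + t2 + (u2 + t3) - t4 =
    (u1 + u2) + (t1 + t2 + t3 - t4) := by intros; ring
  rw [e3]
  simp only [← Finset.sum_add_distrib, ← Finset.sum_sub_distrib]
  congr 1
  · push_cast; ring
  · apply Finset.sum_congr rfl
    intro l _
    have := PP_rec n q l
    have h : (PP (n + 2) (q + 1) (l + 1) : ℝ) = PP (n + 1) (q + 1) (l + 1) + PP (n + 1) (q + 1) l
      + PP n q (l + 1) - PP n (q + 1) l := by
      rw [eq_sub_iff_add_eq]; exact_mod_cast this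
    rw [h]; ring

lemma SS_zero (Q L : ℝ) : SS Q L 0 = 1 := by
  rw [SS_eq Q L 0 1 (by omega)]; simp [PP_00]

lemma SS_one (Q L : ℝ) : SS Q L 1 = 1 := by
  rw [SS_eq Q L 1 2 (by omega)]; simp [Finset.sum_range_succ, PP]

lemma y_rec (x : ℤ → ℝ) (hpos : ∀ n, 0 < x n)
    (heven : ∀ n : ℤ, x (2 * n) = (1 + x (2 * n - 1)) / x (2 * n - 2))
    (hodd : ∀ n : ℤ, x (2 * n + 1) = (1 + x (2 * n) ^ 4) / x (2 * n - 1)) (n : ℕ) :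
    x (2 * ((n + 1 : ℕ) : ℤ)) * x (2 * (n : ℤ)) = 1 + x (2 * n + 1) ∧
    x (2 * ((n + 1 : ℕ) : ℤ)) ^ 2 + x (2 * (n : ℤ)) ^ 2 =
      (((1 + x 1) ^ 2 + x 0 ^ 4) / (x 1 * x 0 ^ 2)) * x (2 * n + 1) := by
  have E : ∀ n : ℕ, x (2 * ((n + 1 : ℕ) : ℤ)) * x (2 * (n : ℤ)) = 1 + x (2 * n + 1) := by
    intro n
    have h := heven ((n + 1 : ℕ) : ℤ)
    have i1 : 2 * ((n + 1 : ℕ) : ℤ) - 1 = 2 * n + 1 := by push_cast; ring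
    have i2 : 2 * ((n + 1 : ℕ) : ℤ) - 2 = 2 * n := by push_cast; ring
    rw [i1, i2] at h
    rw [h, div_mul_cancel₀ _ (hpos _).ne']
  have O : ∀ n : ℕ, x (2 * ((n + 1 : ℕ) : ℤ) + 1) * x (2 * (n : ℤ) + 1) =
      1 + x (2 * ((n + 1 : ℕ) : ℤ)) ^ 4 := by
    intro n
    have h := hodd ((n + 1 : ℕ) : ℤ)
    have i1 : 2 * ((n + 1 : ℕ) : ℤ) - 1 = 2 * n + 1 := by push_cast; ring
    rw [i1] at h
    rw [h, div_mul_cancel₀ _ (hpos _).ne']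
  refine ⟨E n, ?_⟩
  induction n with
  | zero =>
    have h := E 0
    have p0 := hpos 0
    have p1 := hpos 1
    simp only [Nat.cast_zero, mul_zero, zero_add] at h ⊢
    rw [← h]
    field_simp
  | succ n ih =>
    have h1 := E n
    have h2 := E (n + 1)
    have h3 := O n
    generalize ((1 + x 1) ^ 2 + x 0 ^ 4) / (x 1 * x 0 ^ 2) = K at *
    have p1 := hpos (2 * (n : ℤ))
    have p2 := hpos (2 * (n : ℤ) + 1)
    have p3 := hpos (2 * ((n + 1 : ℕ) : ℤ))
    generalize x (2 * (n : ℤ)) = y0 at *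
    generalize x (2 * (n : ℤ) + 1) = o0 at *
    generalize x (2 * ((n + 1 : ℕ) : ℤ)) = y1 at *
    generalize x (2 * ((n + 1 : ℕ) : ℤ) + 1) = o1 at *
    generalize x (2 * ((n + 1 + 1 : ℕ) : ℤ)) = y2 at *
    have hy2 : y2 = (1 + o1) / y1 := by field_simp; linarith
    have ho1 : o1 = (1 + y1 ^ 4) / o0 := by field_simp; linarith
    have ho0 : o0 = y1 * y0 - 1 := by linarith
    have hK : K = (y1 ^ 2 + y0 ^ 2) / o0 := by field_simp; linarith
    rw [hy2, hK, ho1]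
    field_simp
    rw [ho0]
    ring

lemma mul_fs (f : ℕ → ℝ) (c : ℝ) : ∑ᶠ i, c * f i = c * ∑ᶠ i, f i := by
  have := smul_finsum c f
  simpa [smul_eq_mul] using this.symm

/-- explicit expression for x_{2n} in terms of (x_0, x_1). -/
theorem q14_explicit_case0 (x : ℤ → ℝ) (hpos : ∀ n, 0 < x n)
    (heven : ∀ n : ℤ, x (2 * n) = (1 + x (2 * n - 1)) / x (2 * n - 2))
    (hodd : ∀ n : ℤ, x (2 * n + 1) = (1 + x (2 * n) ^ 4) / x (2 * n - 1))
    (n : ℕ) :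
    x (2 * (n : ℤ)) =
      ∑ᶠ (q : ℕ), ∑ᶠ (l : ℕ), ∑ᶠ (r : ℕ), ∑ᶠ (s : ℕ), ∑ᶠ (m : ℕ),
        x 0 ^ (1 + 4 * ((q : ℤ) + (l : ℤ)) - 2 * (n : ℤ) - 4 * ((r : ℤ) + (s : ℤ))) *
        x 1 ^ ((m : ℤ) - (q : ℤ) - (l : ℤ)) *
        ((intMultinomial ((n : ℤ) - q - l) [(q : ℤ) - r, (r : ℤ)] *
          intMultinomial ((q : ℤ) + l - 1) [(l : ℤ) - s, (s : ℤ)] *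
          intChoose ((n : ℤ) + 2 * r + s - 2 * q - l) (m : ℤ) : ℤ) : ℝ) := by
  have hp0 := hpos 0
  have hp1 := hpos 1
  simp only [q14_inner (x 0) (x 1) hp0 hp1]
  have hrec := y_rec x hpos heven hodd
  set a := x 0 with hadef
  set b := x 1 with hbdef
  set Q := (a ^ 4 + (1 + b) ^ 2) / (b * (1 + b) ^ 2) with hQ
  set L := (a ^ 4 + (1 + b)) / (b * (1 + b)) with hL
  have hS : ∑ᶠ (q : ℕ), ∑ᶠ (l : ℕ), a * ((1 + b) / a ^ 2) ^ n * ((PP n q l : ℝ) * Q ^ q * L ^ l)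
      = a * ((1 + b) / a ^ 2) ^ n * SS Q L n := by
    have hc : a * ((1 + b) / a ^ 2) ^ n ≠ 0 := by positivity
    unfold SS
    simp only [mul_fs]
  rw [hS]
  suffices H : ∀ n : ℕ, x (2 * (n : ℤ)) = a * ((1 + b) / a ^ 2) ^ n * SS Q L n ∧
      x (2 * ((n + 1 : ℕ) : ℤ)) = a * ((1 + b) / a ^ 2) ^ (n + 1) * SS Q L (n + 1) from (H n).1
  intro n
  induction n with
  | zero =>
    have h := (hrec 0).1
    simp only [Nat.cast_zero, mul_zero, zero_add, SS_zero, SS_one, pow_zero, pow_one, mul_one] at h ⊢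
    refine ⟨rfl, ?_⟩
    rw [← hadef, ← hbdef] at h
    field_simp
    linarith
  | succ n ih =>
    refine ⟨ih.2, ?_⟩
    obtain ⟨i1, i2⟩ := ih
    have r1 := hrec n
    have r2 := hrec (n + 1)
    have h3 : x (2 * ((n + 1 + 1 : ℕ) : ℤ)) =
        (((1 + b) ^ 2 + a ^ 4) / (b * a ^ 2)) * x (2 * ((n + 1 : ℕ) : ℤ)) - x (2 * (n : ℤ)) := by
      have o := hodd ((n + 1 : ℕ) : ℤ)
      have i1 : 2 * ((n + 1 : ℕ) : ℤ) - 1 = 2 * n + 1 := by push_cast; ring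
      rw [i1, eq_div_iff (hpos _).ne'] at o
      have p1 := hpos (2 * (n : ℤ))
      have p2 := hpos (2 * (n : ℤ) + 1)
      have p3 := hpos (2 * ((n + 1 : ℕ) : ℤ))
      obtain ⟨r11, r12⟩ := r1
      obtain ⟨r21, r22⟩ := r2
      generalize ((1 + b) ^ 2 + a ^ 4) / (b * a ^ 2) = K at *
      generalize x (2 * (n : ℤ)) = y0 at *
      generalize x (2 * (n : ℤ) + 1) = o0 at *
      generalize x (2 * ((n + 1 : ℕ) : ℤ)) = y1 at *
      generalize x (2 * ((n + 1 : ℕ) : ℤ) + 1) = o1 at *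
      generalize x (2 * ((n + 1 + 1 : ℕ) : ℤ)) = y2 at *
      have hK : K = (y1 ^ 2 + y0 ^ 2) / o0 := by field_simp; linarith
      have hy2 : y2 = (1 + o1) / y1 := by field_simp; linarith
      have ho1 : o1 = (1 + y1 ^ 4) / o0 := by field_simp; linarith
      have ho0 : o0 = y1 * y0 - 1 := by linarith
      rw [hK, hy2, ho1]
      field_simp
      rw [ho0]
      ring
    rw [h3, i1, i2, SS_rec Q L n]
    have hQL : Q - L = - (a ^ 2 / (1 + b)) ^ 2 := by
      rw [hQ, hL]; field_simp; ring
    have hL1 : ((1 + b) ^ 2 + a ^ 4) / (b * a ^ 2) = (1 + b) / a ^ 2 * (1 + L) := by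
      rw [hL]; field_simp; ring
    rw [hQL, hL1]
    have hinv : a ^ 2 / (1 + b) = ((1 + b) / a ^ 2)⁻¹ := by rw [inv_div]
    rw [hinv]
    have hu : (1 + b) / a ^ 2 ≠ 0 := by positivity
    generalize (1 + b) / a ^ 2 = u at *
    field_simp
    ring
end

section
/- Let (R_{α,n}) be an A_r Q-system solution with weight vectors y(k). Then: (a) for each p ∈ {0,1,…,r+1}, the hard-particle partition function Z_p^{G_r}(y(k)) is independent of k ∈ ℤ; and (b) for all n ∈ ℤ, Σ_{m=0}^{r+1} (−1)^m·Z_{r+1−m}^{G_r}(y(0))·R_{1, n+m} = 0, i.e. the conserved quantities of the Q-system linear recursion are the hard-particle partition functions on G_r with weights y(k). -/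
/-- The edge set of the graph G_r: edges (1,2), (2r,2r+1), and
(2i,2i+1), (2i,2i+2), (2i+1,2i+2) for 1 ≤ i ≤ r−1. -/
def grEdges (r : ℕ) : Finset (ℕ × ℕ) :=
  {(1, 2), (2 * r, 2 * r + 1)} ∪
    (Finset.Icc 1 (r - 1)).biUnion fun i =>
      {(2 * i, 2 * i + 1), (2 * i, 2 * i + 2), (2 * i + 1, 2 * i + 2)}

/-- Adjacency in the graph G_r. -/
def grAdj (r : ℕ) (a b : ℕ) : Prop := (a, b) ∈ grEdges r ∨ (b, a) ∈ grEdges r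

instance (r a b : ℕ) : Decidable (grAdj r a b) :=
  inferInstanceAs (Decidable ((a, b) ∈ grEdges r ∨ (b, a) ∈ grEdges r))

/-- The hard-particle partition function Z_m^{G_r}(y). -/
noncomputable def hardZ (r m : ℕ) (y : ℕ → ℝ) : ℝ :=
  ∑ c ∈ (Finset.powersetCard m (Finset.Icc 1 (2 * r + 1))).filter
      (fun c => ∀ a ∈ c, ∀ b ∈ c, ¬ grAdj r a b),
    ∏ i ∈ c, y i

/-- The weights y(k) built from an A_r Q-system solution:
y_{2α−1,k} = (R_{α−1,k}·R_{α,k+1})/(R_{α,k}·R_{α−1,k+1}) for 1 ≤ α ≤ r+1 and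
y_{2α,k} = (R_{α−1,k}·R_{α+1,k+1})/(R_{α,k}·R_{α,k+1}) for 1 ≤ α ≤ r
(an index a = 2α−1 is odd, a = 2α is even). -/
noncomputable def qWeight (R : ℕ → ℤ → ℝ) (k : ℤ) (a : ℕ) : ℝ :=
  if a % 2 = 1 then
    R ((a + 1) / 2 - 1) k * R ((a + 1) / 2) (k + 1) /
      (R ((a + 1) / 2) k * R ((a + 1) / 2 - 1) (k + 1))
  else
    R (a / 2 - 1) k * R (a / 2 + 1) (k + 1) / (R (a / 2) k * R (a / 2) (k + 1))

open Polynomial in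
/-- The operator polynomials: `p_{i+1} = (y_{2i+1} - X) p_i - y_{2i} X p_{i-1}`. -/
noncomputable def opPoly (y : ℕ → ℝ) : ℕ → ℝ[X]
  | 0 => 1
  | 1 => C (y 1) - X
  | (i + 2) => (C (y (2 * i + 3)) - X) * opPoly y (i + 1) - C (y (2 * i + 2)) * X * opPoly y i

/-- Partition function restricted to vertices `1..N`. -/
noncomputable def indZ (r N m : ℕ) (y : ℕ → ℝ) : ℝ :=
  ∑ c ∈ (Finset.powersetCard m (Finset.Icc 1 N)).filter
      (fun c => ∀ a ∈ c, ∀ b ∈ c, ¬ grAdj r a b),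
    ∏ i ∈ c, y i

lemma mem_grEdges (r : ℕ) (hr : 1 ≤ r) (a b : ℕ) (hb : b ≤ 2 * r + 1) (ha : 1 ≤ a) :
    (a, b) ∈ grEdges r ↔ (b = a + 1 ∨ (b = a + 2 ∧ b % 2 = 0)) := by
  simp only [grEdges, Finset.mem_union, Finset.mem_insert, Finset.mem_singleton,
    Finset.mem_biUnion, Finset.mem_Icc, Prod.mk.injEq]
  constructor
  · rintro ((h | h) | ⟨i, hi, h | h | h⟩) <;> omega
  · intro h
    by_cases h1 : a = 1 ∧ b = 2
    · exact Or.inl (Or.inl h1)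
    by_cases h2 : a = 2 * r ∧ b = 2 * r + 1
    · exact Or.inl (Or.inr h2)
    · refine Or.inr ⟨a / 2, ?_, ?_⟩ <;> omega

lemma indZ_zero (r N : ℕ) (y : ℕ → ℝ) : indZ r N 0 y = 1 := by
  simp [indZ, Finset.filter_singleton]

lemma indZ_nil (r m : ℕ) (y : ℕ → ℝ) : indZ r 0 (m + 1) y = 0 := by
  have : Finset.powersetCard (m + 1) (Finset.Icc 1 0) = ∅ := by
    rw [Finset.powersetCard_eq_empty]; simp
  rw [indZ, this]; simp

lemma indZ_succ (r : ℕ) (hr : 1 ≤ r) (N nb m : ℕ) (y : ℕ → ℝ) (hN : N + 1 ≤ 2 * r + 1)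
    (hnb : nb ≤ N)
    (h : ∀ a, 1 ≤ a → a ≤ N → ((N + 1 = a + 1 ∨ (N + 1 = a + 2 ∧ (N + 1) % 2 = 0)) ↔ nb < a)) :
    indZ r (N + 1) (m + 1) y = indZ r N (m + 1) y + y (N + 1) * indZ r nb m y := by
  have hadj : ∀ a, 1 ≤ a → a ≤ N → (grAdj r a (N + 1) ↔ nb < a) := by
    intro a h1 h2
    rw [grAdj, mem_grEdges r hr _ _ hN h1, mem_grEdges r hr _ _ (by omega) (by omega), ← h a h1 h2]
    omega
  have hadj' : ∀ a, 1 ≤ a → a ≤ N → (grAdj r (N + 1) a ↔ nb < a) := by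
    intro a h1 h2
    rw [← hadj a h1 h2, grAdj, grAdj, or_comm]
  have hself : ¬ grAdj r (N + 1) (N + 1) := by
    rw [grAdj, mem_grEdges r hr _ _ hN (by omega)]
    omega
  have hI : Finset.Icc 1 (N + 1) = insert (N + 1) (Finset.Icc 1 N) := by
    ext x; simp only [Finset.mem_Icc, Finset.mem_insert]; omega
  have hnot : N + 1 ∉ Finset.Icc 1 N := by simp
  unfold indZ
  rw [hI, Finset.powersetCard_succ_insert hnot, Finset.filter_union, Finset.sum_union]
  · congr 1
    rw [Finset.mul_sum]
    symm
    refine Finset.sum_bij (fun c _ => insert (N + 1) c) ?_ ?_ ?_ ?_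
    · intro c hc
      simp only [Finset.mem_filter, Finset.mem_powersetCard] at hc
      obtain ⟨⟨hs, hcard⟩, hind⟩ := hc
      have hb : ∀ a ∈ c, 1 ≤ a ∧ a ≤ nb := fun a ha => Finset.mem_Icc.1 (hs ha)
      simp only [Finset.mem_filter, Finset.mem_image, Finset.mem_powersetCard]
      refine ⟨⟨c, ⟨fun a ha => ?_, hcard⟩, rfl⟩, ?_⟩
      · have := hb a ha
        rw [Finset.mem_Icc]; omega
      · intro a ha b hb'
        rw [Finset.mem_insert] at ha hb'
        rcases ha with rfl | ha <;> rcases hb' with rfl | hb'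
        · exact hself
        · have := hb b hb'
          rw [hadj' b (by omega) (by omega)]; omega
        · have := hb a ha
          rw [hadj a (by omega) (by omega)]; omega
        · exact hind a ha b hb'
    · intro c hc d hd hcd
      simp only [Finset.mem_filter, Finset.mem_powersetCard] at hc hd
      have hc' : N + 1 ∉ c := fun hh => by
        have := Finset.mem_Icc.1 (hc.1.1 hh); omega
      have hd' : N + 1 ∉ d := fun hh => by
        have := Finset.mem_Icc.1 (hd.1.1 hh); omega
      rw [← Finset.erase_insert hc', ← Finset.erase_insert hd']
      exact congrArg (fun s => Finset.erase s (N + 1)) hcd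
    · intro d hd
      simp only [Finset.mem_filter, Finset.mem_image, Finset.mem_powersetCard] at hd
      obtain ⟨⟨c, ⟨hs, hcard⟩, rfl⟩, hind⟩ := hd
      refine ⟨c, ?_, rfl⟩
      simp only [Finset.mem_filter, Finset.mem_powersetCard]
      refine ⟨⟨fun a ha => ?_, hcard⟩, fun a ha b hb => hind a (Finset.mem_insert_of_mem ha) b
        (Finset.mem_insert_of_mem hb)⟩
      have h1 := Finset.mem_Icc.1 (hs ha)
      have h2 := hind a (Finset.mem_insert_of_mem ha) (N + 1) (Finset.mem_insert_self _ _)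
      rw [hadj a h1.1 h1.2] at h2
      rw [Finset.mem_Icc]; omega
    · intro c hc
      simp only [Finset.mem_filter, Finset.mem_powersetCard] at hc
      have hc' : N + 1 ∉ c := fun hh => by
        have := Finset.mem_Icc.1 (hc.1.1 hh); omega
      rw [Finset.prod_insert hc']
  · rw [Finset.disjoint_left]
    intro c hc hd
    simp only [Finset.mem_filter, Finset.mem_image, Finset.mem_powersetCard] at hc hd
    obtain ⟨⟨d, _, rfl⟩, _⟩ := hd
    exact hnot (hc.1.1 (Finset.mem_insert_self _ _))

/-- Three-term recursion; `N` runs over `0, 1, 3, 5, …`. -/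
lemma indZ_step (r : ℕ) (hr : 1 ≤ r) (i m : ℕ) (y : ℕ → ℝ) (hi : i + 1 ≤ r) :
    indZ r (2 * (i + 2) - 1) (m + 1) y = indZ r (2 * (i + 1) - 1) (m + 1) y
      + y (2 * i + 3) * indZ r (2 * (i + 1) - 1) m y + y (2 * i + 2) * indZ r (2 * i - 1) m y := by
  have e1 : 2 * (i + 2) - 1 = (2 * i + 2) + 1 := by omega
  have e2 : 2 * (i + 1) - 1 = 2 * i + 1 := by omega
  rw [e1, e2, indZ_succ r hr (2 * i + 2) (2 * i + 1) m y (by omega) (by omega) (by omega),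
    indZ_succ r hr (2 * i + 1) (2 * i - 1) m y (by omega) (by omega) (by omega)]
  ring

lemma indZ_one (r : ℕ) (hr : 1 ≤ r) (m : ℕ) (y : ℕ → ℝ) :
    indZ r 1 (m + 1) y = y 1 * indZ r 0 m y := by
  have := indZ_succ r hr 0 0 m y (by omega) (by omega) (by omega)
  rw [zero_add] at this
  rw [this, indZ_nil, zero_add]

lemma indZ_vanish (r : ℕ) (hr : 1 ≤ r) (y : ℕ → ℝ) :
    ∀ i, i ≤ r + 1 → ∀ j, i < j → indZ r (2 * i - 1) j y = 0
  | 0, _, j + 1, _ => indZ_nil r j y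
  | 1, _, j + 2, _ => by
      show indZ r 1 (j + 1 + 1) y = 0
      rw [indZ_one r hr, indZ_nil, mul_zero]
  | 1, _, 1, h => by omega
  | (i + 2), hi, j + 1, h => by
      rw [indZ_step r hr i j y (by omega),
        indZ_vanish r hr y (i + 1) (by omega) (j + 1) (by omega),
        indZ_vanish r hr y (i + 1) (by omega) j (by omega),
        indZ_vanish r hr y i (by omega) j (by omega)]
      ring

open Polynomial in
lemma opPoly_coeff_step (y : ℕ → ℝ) (i m : ℕ) :
    (opPoly y (i + 2)).coeff (m + 1) = y (2 * i + 3) * (opPoly y (i + 1)).coeff (m + 1)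
      - (opPoly y (i + 1)).coeff m - y (2 * i + 2) * (opPoly y i).coeff m := by
  rw [opPoly, sub_mul, mul_assoc (C _) X]
  simp

open Polynomial in
lemma opPoly_coeff_step_zero (y : ℕ → ℝ) (i : ℕ) :
    (opPoly y (i + 2)).coeff 0 = y (2 * i + 3) * (opPoly y (i + 1)).coeff 0 := by
  rw [opPoly, sub_mul, mul_assoc (C _) X]
  simp

open Polynomial in
lemma opPoly_coeff_gt (y : ℕ → ℝ) : ∀ i m, i < m → (opPoly y i).coeff m = 0
  | 0, m + 1, _ => by simp [opPoly, coeff_one]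
  | 1, m + 2, _ => by simp [opPoly, coeff_X]
  | 1, 1, h => by omega
  | (i + 2), m + 1, h => by
      rw [opPoly_coeff_step, opPoly_coeff_gt y (i + 1) _ (by omega),
        opPoly_coeff_gt y (i + 1) _ (by omega), opPoly_coeff_gt y i _ (by omega)]
      ring

open Polynomial in
lemma opPoly_coeff (r : ℕ) (hr : 1 ≤ r) (y : ℕ → ℝ) :
    ∀ i, i ≤ r + 1 → ∀ m j, m + j = i →
      (opPoly y i).coeff m = (-1) ^ m * indZ r (2 * i - 1) j y
  | 0, _, m, j, h => by
      obtain ⟨rfl, rfl⟩ : m = 0 ∧ j = 0 := by omega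
      simp [opPoly, indZ_zero]
  | 1, _, m, j, h => by
      obtain ⟨rfl, rfl⟩ | ⟨rfl, rfl⟩ : (m = 0 ∧ j = 0 + 1) ∨ (m = 1 ∧ j = 0) := by omega
      · show _ = (-1) ^ 0 * indZ r 1 (0 + 1) y
        rw [indZ_one r hr]
        simp [opPoly, indZ_zero]
      · simp [opPoly, indZ_zero]
  | (i + 2), hi, 0, j, h => by
      obtain rfl : j = (i + 1) + 1 := by omega
      rw [opPoly_coeff_step_zero, indZ_step r hr i (i + 1) y (by omega),
        opPoly_coeff r hr y (i + 1) (by omega) 0 (i + 1) (by omega),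
        indZ_vanish r hr y (i + 1) (by omega) (i + 1 + 1) (by omega),
        indZ_vanish r hr y i (by omega) (i + 1) (by omega)]
      ring
  | (i + 2), hi, m + 1, 0, h => by
      rw [opPoly_coeff_step, opPoly_coeff_gt y (i + 1) (m + 1) (by omega),
        opPoly_coeff_gt y i m (by omega),
        opPoly_coeff r hr y (i + 1) (by omega) m 0 (by omega), indZ_zero, indZ_zero]
      ring
  | (i + 2), hi, m + 1, j + 1, h => by
      rw [opPoly_coeff_step, indZ_step r hr i j y (by omega),
        opPoly_coeff r hr y (i + 1) (by omega) (m + 1) j (by omega),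
        opPoly_coeff r hr y (i + 1) (by omega) m (j + 1) (by omega),
        opPoly_coeff r hr y i (by omega) m j (by omega)]
      ring

open Polynomial in
lemma opPoly_step (y : ℕ → ℝ) (i : ℕ) : opPoly y (i + 2) =
    (C (y (2 * i + 3)) - X) * opPoly y (i + 1) - C (y (2 * i + 2)) * X * opPoly y i := by
  rw [opPoly]

open Polynomial in
lemma opPoly_shift (r : ℕ) (y z : ℕ → ℝ) (h0 : z 1 = y 1 + y 2)
    (h1 : ∀ i, i < r → z (2 * i + 3) + z (2 * i + 2) = y (2 * i + 3) + y (2 * i + 4))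
    (h2 : ∀ i, i < r → z (2 * i + 3) * y (2 * i + 2) = z (2 * i + 2) * y (2 * i + 1)) :
    ∀ i, i ≤ r → opPoly z (i + 1) = opPoly y (i + 1) + C (y (2 * i + 2)) * opPoly y i
  | 0, _ => by
      simp only [opPoly, h0, zero_add, mul_zero, C_add]
      ring
  | 1, hi => by
      have a1 := congrArg (C : ℝ → ℝ[X]) (h1 0 (by omega))
      have a2 := congrArg (C : ℝ → ℝ[X]) (h2 0 (by omega))
      simp only [C_add, C_mul, mul_zero, zero_add] at a1 a2
      simp only [opPoly, h0, zero_add, mul_zero, C_add, mul_one]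
      norm_num at a1 a2 ⊢
      linear_combination (C (y 1) - X) * a1 + a2
  | (i + 2), hi => by
      have b1 := opPoly_shift r y z h0 h1 h2 (i + 1) (by omega)
      have b2 := opPoly_shift r y z h0 h1 h2 i (by omega)
      have a1 := congrArg (C : ℝ → ℝ[X]) (h1 (i + 1) (by omega))
      have a2 := congrArg (C : ℝ → ℝ[X]) (h2 (i + 1) (by omega))
      simp only [C_add, C_mul] at a1 a2
      have c1 : opPoly y (i + 2) = (C (y (2 * i + 3)) - X) * opPoly y (i + 1)
        - C (y (2 * i + 2)) * X * opPoly y i := by rw [opPoly]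
      rw [opPoly_step z (i + 1), b1, b2, opPoly_step y (i + 1)]
      simp only [show 2 * (i + 1) + 1 = 2 * i + 3 by ring, show 2 * (i + 1) + 2 = 2 * i + 4 by ring,
        show 2 * (i + 1) + 3 = 2 * i + 5 by ring, show 2 * (i + 1) + 4 = 2 * i + 6 by ring,
        show 2 * (i + 2) + 2 = 2 * i + 6 by ring, show i + 1 + 1 = i + 2 by ring] at *
      linear_combination opPoly y (i + 2) * a1 + opPoly y (i + 1) * a2
        - C (z (2 * i + 4)) * c1

open Polynomial in
/-- The linear functional `X ^ m ↦ f (n + m)`. -/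
noncomputable def fnl (f : ℤ → ℝ) (n : ℤ) (p : ℝ[X]) : ℝ :=
  p.sum fun m a => a * f (n + m)

open Polynomial in
lemma fnl_add (f : ℤ → ℝ) (n : ℤ) (p q : ℝ[X]) : fnl f n (p + q) = fnl f n p + fnl f n q := by
  unfold fnl
  exact sum_add_index p q _ (by simp) (by intros; ring)

open Polynomial in
lemma fnl_C_mul (f : ℤ → ℝ) (n : ℤ) (c : ℝ) (p : ℝ[X]) :
    fnl f n (C c * p) = c * fnl f n p := by
  induction p using Polynomial.induction_on' with
  | add p q hp hq => rw [mul_add, fnl_add, fnl_add, hp, hq]; ring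
  | monomial m a =>
    rw [C_mul_monomial]
    unfold fnl
    rw [sum_monomial_index _ _ (by simp), sum_monomial_index _ _ (by simp)]
    ring

open Polynomial in
lemma fnl_X_mul (f : ℤ → ℝ) (n : ℤ) (p : ℝ[X]) :
    fnl f n (X * p) = fnl f (n + 1) p := by
  induction p using Polynomial.induction_on' with
  | add p q hp hq => rw [mul_add, fnl_add, fnl_add, hp, hq]
  | monomial m a =>
    rw [X_mul_monomial]
    unfold fnl
    rw [sum_monomial_index _ _ (by simp), sum_monomial_index _ _ (by simp)]
    push_cast
    rw [show n + ((m : ℤ) + 1) = n + 1 + m by ring]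

open Polynomial in
lemma fnl_one (f : ℤ → ℝ) (n : ℤ) : fnl f n 1 = f n := by
  unfold fnl
  rw [← monomial_zero_one, sum_monomial_index _ _ (by simp)]
  simp

open Polynomial in
lemma fnl_opPoly (r : ℕ) (f : ℤ → ℝ) (Y : ℤ → ℕ → ℝ) (h0 : ∀ k, f (k + 1) = Y k 1 * f k)
    (hs : ∀ k i, i ≤ r → opPoly (Y (k + 1)) (i + 1) =
      opPoly (Y k) (i + 1) + C (Y k (2 * i + 2)) * opPoly (Y k) i) :
    ∀ i, i ≤ r → ∀ k, fnl f k (opPoly (Y k) (i + 1)) = 0 := by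
  intro i
  induction i with
  | zero =>
    intro _ k
    have e : opPoly (Y k) (0 + 1) = C (Y k 1) * 1 + C (-1) * (X * 1) := by
      simp [opPoly, sub_eq_add_neg]
    rw [e, fnl_add, fnl_C_mul, fnl_C_mul, fnl_X_mul, fnl_one, fnl_one, h0]
    ring
  | succ i ih =>
    intro hi k
    have e : opPoly (Y k) (i + 1 + 1) = C (Y k (2 * i + 3)) * opPoly (Y k) (i + 1)
        + C (-1) * (X * opPoly (Y (k + 1)) (i + 1)) := by
      rw [opPoly_step, hs k i (by omega)]
      simp only [C_neg, C_1]
      ring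
    rw [e, fnl_add, fnl_C_mul, fnl_C_mul, fnl_X_mul, ih (by omega), ih (by omega)]
    ring

lemma qWeight_odd (R : ℕ → ℤ → ℝ) (k : ℤ) (i : ℕ) : qWeight R k (2 * i + 1) =
    R i k * R (i + 1) (k + 1) / (R (i + 1) k * R i (k + 1)) := by
  rw [qWeight, if_pos (by omega), show (2 * i + 1 + 1) / 2 = i + 1 by omega]
  simp

lemma qWeight_even (R : ℕ → ℤ → ℝ) (k : ℤ) (i : ℕ) : qWeight R k (2 * i + 2) =
    R i k * R (i + 2) (k + 1) / (R (i + 1) k * R (i + 1) (k + 1)) := by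
  rw [qWeight, if_neg (by omega), show (2 * i + 2) / 2 = i + 1 by omega]
  simp

/-- The core result for a Q-system solution extended by `R (r + 2) = 0`. -/
lemma qsystem_core (r : ℕ) (R : ℕ → ℤ → ℝ)
    (hpos : ∀ α, α ≤ r + 1 → ∀ n : ℤ, 0 < R α n)
    (hbd0 : ∀ n : ℤ, R 0 n = 1) (hbd2 : ∀ n : ℤ, R (r + 2) n = 0)
    (hQ : ∀ α, α ≤ r → ∀ n : ℤ,
      R (α + 1) (n + 1 + 1) * R (α + 1) n = R (α + 1) (n + 1) ^ 2 + R (α + 2) (n + 1) * R α (n + 1)) :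
    (∀ k k' : ℤ, opPoly (qWeight R k) (r + 1) = opPoly (qWeight R k') (r + 1)) ∧
    (∀ n : ℤ, fnl (R 1) n (opPoly (qWeight R 0) (r + 1)) = 0) := by
  have hs : ∀ (k : ℤ) i, i ≤ r → opPoly (qWeight R (k + 1)) (i + 1) =
      opPoly (qWeight R k) (i + 1) +
        Polynomial.C (qWeight R k (2 * i + 2)) * opPoly (qWeight R k) i := by
    intro k
    apply opPoly_shift
    · rw [show 1 = 2 * 0 + 1 by rfl, show 2 = 2 * 0 + 2 by rfl, qWeight_odd, qWeight_odd,
        qWeight_even]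
      have h1 := hpos 1 (by omega) k
      have h2 := hpos 1 (by omega) (k + 1)
      have hq := hQ 0 (by omega) k
      simp only [hbd0, zero_add, mul_one, one_mul] at hq ⊢
      field_simp
      linear_combination hq
    · intro i hi
      rw [show 2 * i + 3 = 2 * (i + 1) + 1 by ring, show 2 * i + 4 = 2 * (i + 1) + 2 by ring,
        qWeight_odd, qWeight_odd, qWeight_even, qWeight_even]
      have h1 := hpos (i + 1) (by omega) (k + 1)
      have h2 := hpos (i + 1) (by omega) (k + 1 + 1)
      have h3 := hpos (i + 2) (by omega) (k + 1)
      have h4 := hpos (i + 2) (by omega) k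
      have q1 := hQ i (by omega) k
      have q2 := hQ (i + 1) (by omega) k
      simp only [show i + 1 + 1 = i + 2 by ring, show i + 1 + 2 = i + 3 by ring] at *
      have l : R (i + 1) (k + 1) * R (i + 2) (k + 1 + 1) /
            (R (i + 2) (k + 1) * R (i + 1) (k + 1 + 1)) +
          R i (k + 1) * R (i + 2) (k + 1 + 1) / (R (i + 1) (k + 1) * R (i + 1) (k + 1 + 1)) =
          R (i + 1) k * R (i + 2) (k + 1 + 1) / (R (i + 1) (k + 1) * R (i + 2) (k + 1)) := by
        field_simp
        linear_combination -R (i + 2) (k + 1 + 1) * q1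
      rw [l]
      field_simp
      linear_combination R (i + 1) k * q2
    · intro i hi
      rw [show 2 * i + 3 = 2 * (i + 1) + 1 by ring,
        qWeight_odd, qWeight_odd, qWeight_even, qWeight_even]
      have h0 := hpos i (by omega) (k + 1)
      have h1 := hpos (i + 1) (by omega) (k + 1)
      have h2 := hpos (i + 1) (by omega) (k + 1 + 1)
      have h3 := hpos (i + 2) (by omega) (k + 1)
      have h4 := hpos (i + 1) (by omega) k
      simp only [show i + 1 + 1 = i + 2 by ring] at *
      field_simp
  have hstep : ∀ k : ℤ, opPoly (qWeight R (k + 1)) (r + 1) = opPoly (qWeight R k) (r + 1) := by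
    intro k
    rw [hs k r le_rfl, qWeight_even, hbd2]
    simp
  have hconst : ∀ k : ℤ, opPoly (qWeight R k) (r + 1) = opPoly (qWeight R 0) (r + 1) := by
    intro k
    induction k using Int.induction_on with
    | zero => rfl
    | succ i ih => rw [hstep, ih]
    | pred i ih => rw [← ih, ← hstep]; congr 3; ring
  refine ⟨fun k k' => (hconst k).trans (hconst k').symm, fun n => ?_⟩
  rw [← hconst n]
  refine fnl_opPoly r (R 1) (fun k => qWeight R k) (fun k => ?_) hs r le_rfl n
  show _ = qWeight R k (2 * 0 + 1) * _
  rw [qWeight_odd, hbd0, hbd0]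
  have h1 := hpos 1 (by omega) k
  simp only [zero_add]
  field_simp

/-- the hard-particle partition functions Z_p^{G_r}(y(k)) do not
depend on k, and they are the conserved quantities of the linear recursion
satisfied by R_{1,n}. -/
theorem qsystem_hardZ_conserved (r : ℕ) (hr : 1 ≤ r) (R : ℕ → ℤ → ℝ)
    (hpos : ∀ α, α ≤ r + 1 → ∀ n : ℤ, 0 < R α n)
    (hbd0 : ∀ n : ℤ, R 0 n = 1) (hbd1 : ∀ n : ℤ, R (r + 1) n = 1)
    (hQ : ∀ α, 1 ≤ α → α ≤ r → ∀ n : ℤ,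
      R α (n + 1) * R α (n - 1) = R α n ^ 2 + R (α + 1) n * R (α - 1) n) :
    (∀ p, p ≤ r + 1 → ∀ k k' : ℤ, hardZ r p (qWeight R k) = hardZ r p (qWeight R k')) ∧
    (∀ n : ℤ, ∑ m ∈ Finset.range (r + 2),
      (-1 : ℝ) ^ m * hardZ r (r + 1 - m) (qWeight R 0) * R 1 (n + (m : ℤ)) = 0) := by
  classical
  set S : ℕ → ℤ → ℝ := fun α n => if α ≤ r + 1 then R α n else 0 with hS
  have hSR : ∀ α, α ≤ r + 1 → ∀ n, S α n = R α n := fun α h n => if_pos h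
  have hw : ∀ k a, a ∈ Finset.Icc 1 (2 * r + 1) → qWeight R k a = qWeight S k a := by
    intro k a ha
    rw [Finset.mem_Icc] at ha
    unfold qWeight
    split_ifs with h
    · rw [hSR _ (by omega), hSR _ (by omega), hSR _ (by omega), hSR _ (by omega)]
    · rw [hSR _ (by omega), hSR _ (by omega), hSR _ (by omega), hSR _ (by omega)]
  have hZ : ∀ k p, hardZ r p (qWeight R k) = indZ r (2 * (r + 1) - 1) p (qWeight S k) := by
    intro k p
    rw [show 2 * (r + 1) - 1 = 2 * r + 1 by omega]
    unfold hardZ indZ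
    refine Finset.sum_congr rfl fun c hc => Finset.prod_congr rfl fun a ha => hw k a ?_
    exact (Finset.mem_powersetCard.1 (Finset.mem_filter.1 hc).1).1 ha
  obtain ⟨hA, hB⟩ := qsystem_core r S
    (fun α h n => by rw [hSR α h]; exact hpos α h n)
    (fun n => by rw [hSR 0 (by omega)]; exact hbd0 n)
    (fun n => if_neg (by omega))
    (fun α h n => by
      rw [hSR (α + 1) (by omega), hSR (α + 1) (by omega), hSR (α + 1) (by omega),
        hSR α (by omega)]
      rcases Nat.lt_or_ge α r with h' | h'
      · rw [hSR _ (by omega)]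
        have := hQ (α + 1) (by omega) (by omega) (n + 1)
        simpa using this
      · obtain rfl : α = r := by omega
        have e : S (α + 2) (n + 1) = 0 := if_neg (by omega)
        rw [e, hbd1, hbd1, hbd1]
        ring)
  refine ⟨fun p hp k k' => ?_, fun n => ?_⟩
  · have h1 := opPoly_coeff r hr (qWeight S k) (r + 1) le_rfl (r + 1 - p) p (by omega)
    have h2 := opPoly_coeff r hr (qWeight S k') (r + 1) le_rfl (r + 1 - p) p (by omega)
    rw [hA k k', h2] at h1
    rw [hZ, hZ]
    exact (mul_left_cancel₀ (pow_ne_zero _ (by norm_num)) h1).symm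
  · rw [← hB n, fnl, Polynomial.sum_over_range' _ (by simp) (r + 2)]
    · refine Finset.sum_congr rfl fun m hm => ?_
      rw [Finset.mem_range] at hm
      rw [opPoly_coeff r hr (qWeight S 0) (r + 1) le_rfl m (r + 1 - m) (by omega), hZ,
        hSR 1 (by omega)]
    · rw [Nat.lt_succ_iff, Polynomial.natDegree_le_iff_coeff_eq_zero]
      intro m hm
      exact opPoly_coeff_gt _ _ _ hm
end

section
/- Let (R_{α,n}) be an A_r Q-system solution with weight vector y(0), and let M be the transfer matrix T_r(t·y(0)) evaluated at t = 1. Then for every integer n ≥ 0, R_{1,n} = R_{1,0}·(M^{2n})_{0,0}, i.e. R_{1,n}/R_{1,0} is the partition function of weighted paths of 2n steps on the dual graph from vertex 0 to itself. -/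
/-- The transfer matrix T_r(t·y), a (2r+2)×(2r+2) matrix.  The index set
0 < 1 < 2 < 2' < 3 < 3' < ⋯ < r < r' < r+1 < r+2 is encoded by positions
in Fin (2r+2): vertex 0 ↦ 0, vertex 1 ↦ 1, vertex k ↦ 2k−2 and vertex
k' ↦ 2k−1 (2 ≤ k ≤ r), vertex r+1 ↦ 2r, vertex r+2 ↦ 2r+1.  The nonzero
entries are (T_r)_{k',k} = 1, (T_r)_{k,k'} = t·y_{2k−1} (k = 2,…,r);
(T_r)_{k+1,k} = 1, (T_r)_{k,k+1} = t·y_{2k} (k = 1,…,r);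
(T_r)_{1,0} = (T_r)_{r+2,r+1} = 1, (T_r)_{0,1} = t·y_1,
(T_r)_{r+1,r+2} = t·y_{2r+1}. -/
def Tmat (r : ℕ) (t : ℝ) (y : ℕ → ℝ) : Matrix (Fin (2 * r + 2)) (Fin (2 * r + 2)) ℝ :=
  Matrix.of fun p q =>
    if (p : ℕ) = (q : ℕ) + 1 ∧ ((q : ℕ) ≤ 1 ∨ (q : ℕ) % 2 = 0) then 1
    else if (p : ℕ) = (q : ℕ) + 2 ∧ (q : ℕ) % 2 = 0 ∧ 2 ≤ (q : ℕ) then 1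
    else if (q : ℕ) = (p : ℕ) + 1 ∧ ((p : ℕ) ≤ 1 ∨ (p : ℕ) % 2 = 0) then t * y ((p : ℕ) + 1)
    else if (q : ℕ) = (p : ℕ) + 2 ∧ (p : ℕ) % 2 = 0 ∧ 2 ≤ (p : ℕ) then t * y ((p : ℕ) + 2)
    else 0

open PowerSeries in
noncomputable def gAux (r : ℕ) (y : ℕ → ℝ) : ℕ → PowerSeries ℝ
  | 0 => 0
  | d + 1 => (1 - X ^ 2 * (C (y (2 * (r + 1 - d) - 1)) + C (y (2 * (r + 1 - d))) * gAux r y d))⁻¹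

open PowerSeries in
theorem exists_G (r : ℕ) (y : ℕ → ℝ) : ∃ G : ℕ → PowerSeries ℝ, G (r + 2) = 0 ∧
    ∀ k, k ≤ r + 1 →
      G k * (1 - X ^ 2 * (C (y (2 * k - 1)) + C (y (2 * k)) * G (k + 1))) = 1 := by
  refine ⟨fun k => gAux r y (r + 2 - k), by simp [gAux], fun k hk => ?_⟩
  obtain ⟨d, hd⟩ : ∃ d, r + 1 - k = d := ⟨_, rfl⟩
  have h1 : r + 2 - k = d + 1 := by omega
  have h2 : r + 2 - (k + 1) = d := by omega
  have h3 : r + 1 - d = k := by omega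
  simp only [h1, h2, gAux, h3]
  apply PowerSeries.inv_mul_cancel
  simp

open PowerSeries in
theorem main_step (r : ℕ) (y y' c : ℕ → ℝ) (G G' : ℕ → PowerSeries ℝ)
    (hG0 : G (r + 2) = 0) (hG0' : G' (r + 2) = 0)
    (hG : ∀ k, k ≤ r + 1 →
      G k * (1 - X ^ 2 * (C (y (2 * k - 1)) + C (y (2 * k)) * G (k + 1))) = 1)
    (hG' : ∀ k, k ≤ r + 1 →
      G' k * (1 - X ^ 2 * (C (y' (2 * k - 1)) + C (y' (2 * k)) * G' (k + 1))) = 1)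
    (hc : ∀ k, 1 ≤ k → k ≤ r → c k = y (2 * k - 1) + y (2 * k))
    (hcr : c (r + 1) = y (2 * r + 1))
    (h1 : ∀ k, 1 ≤ k → k ≤ r → y' (2 * k + 1) * c k = y (2 * k - 1) * c (k + 1))
    (h2 : ∀ k, 1 ≤ k → k ≤ r → y' (2 * k) + y' (2 * k + 1) = c (k + 1)) :
    ∀ d k, k + d = r + 1 → 1 ≤ k →
      (C (y (2 * k - 1)) + C (y (2 * k)) * G (k + 1)) *
        (1 - X ^ 2 * (C (y' (2 * k)) * G' (k + 1))) = C (c k) := by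
  intro d
  induction d with
  | zero =>
    intro k hk _
    obtain rfl : k = r + 1 := by omega
    rw [hG0, hG0', hcr]
    simp [show 2 * (r + 1) - 1 = 2 * r + 1 by omega]
  | succ d ih =>
    intro k hk hk1
    have I := ih (k + 1) (by omega) (by omega)
    have g := hG (k + 1) (by omega)
    have g' := hG' (k + 1) (by omega)
    have e1 := congrArg (C (R := ℝ)) (hc k hk1 (by omega))
    have e2 := congrArg (C (R := ℝ)) (h1 k hk1 (by omega))
    have e3 := congrArg (C (R := ℝ)) (h2 k hk1 (by omega))
    rw [show 2 * (k + 1) - 1 = 2 * k + 1 by omega] at *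
    simp only [map_add, map_mul] at e1 e2 e3
    generalize C (y (2 * k - 1)) = a at *
    generalize C (y (2 * k)) = b at *
    generalize C (y' (2 * k)) = b' at *
    generalize C (y' (2 * k + 1)) = a' at *
    generalize C (c k) = ck at *
    generalize C (c (k + 1)) = ck1 at *
    generalize C (y (2 * k + 1)) + C (y (2 * (k + 1))) * G (k + 1 + 1) = A at *
    generalize C (y' (2 * (k + 1))) * G' (k + 1 + 1) = u at *
    generalize G (k + 1) = g1 at *
    generalize G' (k + 1) = g1' at *
    generalize (X : PowerSeries ℝ) ^ 2 = t at *
    have k1 : g1 * (1 - t * u - t * ck1) = 1 - t * u := by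
      linear_combination (1 - t * u) * g + g1 * t * I
    have k2 : 1 - t * (b' * g1') = g1' * (1 - t * u - t * ck1) := by
      linear_combination (-1) * g' - g1' * t * e3
    rw [k2]
    linear_combination b * g1' * k1 - g1' * (1 - t * u) * e1 + t * g1' * e2 + ck * g'

noncomputable def tauT (y : ℕ → ℝ) (p q : ℕ) : ℝ :=
    if p = q + 1 ∧ (q ≤ 1 ∨ q % 2 = 0) then 1
    else if p = q + 2 ∧ q % 2 = 0 ∧ 2 ≤ q then 1
    else if q = p + 1 ∧ (p ≤ 1 ∨ p % 2 = 0) then y (p + 1)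
    else if q = p + 2 ∧ p % 2 = 0 ∧ 2 ≤ p then y (p + 2)
    else 0

noncomputable def wS (r : ℕ) (y : ℕ → ℝ) (p : ℕ) : PowerSeries ℝ :=
  PowerSeries.mk fun n => if h : p < 2 * r + 2 then
    ((Tmat r 1 y) ^ n) ⟨p, h⟩ ⟨0, by omega⟩ else 0

open PowerSeries in
theorem wS_eq (r : ℕ) (y : ℕ → ℝ) (p : ℕ) (hp : p < 2 * r + 2) :
    wS r y p = (if p = 0 then 1 else 0) +
      X * ∑ q ∈ Finset.range (2 * r + 2), C (tauT y p q) * wS r y q := by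
  ext n
  cases n with
  | zero =>
    by_cases h : p = 0 <;> simp [wS, hp, h, Matrix.one_apply]
  | succ n =>
    have : coeff (n + 1) (if p = 0 then (1 : PowerSeries ℝ) else 0) = 0 := by
      split_ifs <;> simp [coeff_one]
    rw [map_add, this, zero_add, coeff_succ_X_mul, map_sum]
    simp only [coeff_C_mul]
    rw [← Fin.sum_univ_eq_sum_range (fun q => tauT y p q * coeff n (wS r y q))]
    simp only [wS, coeff_mk, hp, dif_pos, pow_succ', Matrix.mul_apply, Fin.is_lt]
    refine Finset.sum_congr rfl fun q _ => ?_
    simp [Tmat, tauT]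

theorem wS_big (r : ℕ) (y : ℕ → ℝ) (p : ℕ) (hp : 2 * r + 2 ≤ p) : wS r y p = 0 := by
  ext n
  simp [wS, show ¬ p < 2 * r + 2 by omega]

open PowerSeries in
theorem row0 (r : ℕ) (y : ℕ → ℝ) : wS r y 0 = 1 + X * (C (y 1) * wS r y 1) := by
  rw [wS_eq r y 0 (by omega), if_pos rfl, Finset.sum_eq_single 1]
  · simp [tauT]
  · intro q _ hq
    have : tauT y 0 q = 0 := by simp [tauT, hq]
    simp [this]
  · intro h; simp at h

open PowerSeries in
theorem row1 (r : ℕ) (hr : 1 ≤ r) (y : ℕ → ℝ) :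
    wS r y 1 = X * (wS r y 0 + C (y 2) * wS r y 2) := by
  rw [wS_eq r y 1 (by omega), if_neg (by omega), zero_add]
  have : ∀ q, C (tauT y 1 q) * wS r y q =
      (if q = 0 then wS r y q else 0) + (if q = 2 then C (y 2) * wS r y q else 0) := by
    intro q
    have : tauT y 1 q = if q = 0 then 1 else if q = 2 then y 2 else 0 := by
      unfold tauT; split_ifs <;> first | rfl | omega
    rw [this]
    split_ifs <;> first | omega | simp
  simp only [this, Finset.sum_add_distrib, Finset.sum_ite_eq', Finset.mem_range]
  rw [if_pos (by omega), if_pos (by omega)]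

open PowerSeries in
theorem rowE (r : ℕ) (y : ℕ → ℝ) (m j : ℕ) (hm : 1 ≤ m) (hmr : m ≤ r)
    (hj : j = if m = 1 then 1 else 2 * m - 2) :
    wS r y (2 * m) = X * (wS r y j + C (y (2 * m + 1)) * wS r y (2 * m + 1) +
      C (y (2 * m + 2)) * wS r y (2 * m + 2)) := by
  rw [wS_eq r y (2 * m) (by omega), if_neg (by omega), zero_add]
  have hj' : j < 2 * m := by split_ifs at hj <;> omega
  have : ∀ q, C (tauT y (2 * m) q) * wS r y q =
      (if q = j then wS r y q else 0) +
      (if q = 2 * m + 1 then C (y (2 * m + 1)) * wS r y q else 0) +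
      (if q = 2 * m + 2 then C (y (2 * m + 2)) * wS r y q else 0) := by
    intro q
    have : tauT y (2 * m) q = if q = j then 1 else if q = 2 * m + 1 then y (2 * m + 1) else
        if q = 2 * m + 2 then y (2 * m + 2) else 0 := by
      unfold tauT
      split_ifs at hj <;> split_ifs <;> first | rfl | omega
    rw [this]
    split_ifs <;> first | omega | simp
  simp only [this, Finset.sum_add_distrib, Finset.sum_ite_eq', Finset.mem_range]
  rw [if_pos (by omega), if_pos (by omega)]
  split_ifs with h
  · rfl
  · rw [wS_big r y (2 * m + 2) (by omega), mul_zero]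

open PowerSeries in
theorem rowO (r : ℕ) (y : ℕ → ℝ) (m : ℕ) (hm : 1 ≤ m) (hmr : m ≤ r) :
    wS r y (2 * m + 1) = X * wS r y (2 * m) := by
  rw [wS_eq r y (2 * m + 1) (by omega), if_neg (by omega), zero_add,
    Finset.sum_eq_single (2 * m)]
  · simp [tauT]
  · intro q _ hq
    have : tauT y (2 * m + 1) q = 0 := by
      unfold tauT
      split_ifs <;> first | rfl | omega
    simp [this]
  · intro h; simp at h; omega

open PowerSeries in
theorem spine (r : ℕ) (y : ℕ → ℝ) (G : ℕ → PowerSeries ℝ)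
    (hG : ∀ k, k ≤ r + 1 →
      G k * (1 - X ^ 2 * (C (y (2 * k - 1)) + C (y (2 * k)) * G (k + 1))) = 1)
    (hG0 : G (r + 2) = 0) :
    ∀ d m j, m + d = r → 1 ≤ m → (j = if m = 1 then 1 else 2 * m - 2) →
      wS r y (2 * m) = X * G (m + 1) * wS r y j := by
  intro d
  induction d with
  | zero =>
    intro m j hm h1 hj
    obtain rfl : m = r := by omega
    have e := rowE m y m j h1 le_rfl hj
    have g := hG (m + 1) le_rfl
    rw [rowO m y m h1 le_rfl, wS_big m y (2 * m + 2) le_rfl] at e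
    rw [hG0, show 2 * (m + 1) - 1 = 2 * m + 1 by omega] at g
    linear_combination G (m + 1) * e - wS m y (2 * m) * g
  | succ d ih =>
    intro m j hm h1 hj
    have e := rowE r y m j h1 (by omega) hj
    have g := hG (m + 1) (by omega)
    have I := ih (m + 1) (2 * m) (by omega) (by omega) (by rw [if_neg (by omega)]; omega)
    rw [rowO r y m h1 (by omega), show 2 * m + 2 = 2 * (m + 1) by omega, I] at e
    rw [show 2 * (m + 1) - 1 = 2 * m + 1 by omega] at g
    linear_combination G (m + 1) * e - wS r y (2 * m) * g

open PowerSeries in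
theorem shift_identity (r : ℕ) (hr : 1 ≤ r) (y y' c : ℕ → ℝ)
    (hc : ∀ k, 1 ≤ k → k ≤ r → c k = y (2 * k - 1) + y (2 * k))
    (hcr : c (r + 1) = y (2 * r + 1))
    (h0 : y' 1 = c 1)
    (h1 : ∀ k, 1 ≤ k → k ≤ r → y' (2 * k + 1) * c k = y (2 * k - 1) * c (k + 1))
    (h2 : ∀ k, 1 ≤ k → k ≤ r → y' (2 * k) + y' (2 * k + 1) = c (k + 1)) :
    wS r y 0 = 1 + X ^ 2 * (C (y 1) * wS r y' 0) := by
  obtain ⟨G, hG0, hG⟩ := exists_G r y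
  obtain ⟨G', hG0', hG'⟩ := exists_G r y'
  have A := main_step r y y' c G G' hG0 hG0' hG hG' hc hcr h1 h2 r 1 (by omega) le_rfl
  have s := spine r y G hG hG0 (r - 1) 1 1 (by omega) le_rfl (by simp)
  have s' := spine r y' G' hG' hG0' (r - 1) 1 1 (by omega) le_rfl (by simp)
  have g := hG 1 (by omega)
  have a0 := row0 r y
  have a1 := row1 r hr y
  have b0 := row0 r y'
  have b1 := row1 r hr y'
  norm_num at A s s' g
  rw [s] at a1
  rw [s'] at b1
  rw [h0] at b0
  have k1 : wS r y' 0 = G 1 := by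
    linear_combination G 1 * b0 - wS r y' 0 * g - G 1 * X * wS r y' 1 * A +
      G 1 * X * (C (y 1) + C (y 2) * G 2) * b1
  have k2 : wS r y 1 = X * G 1 := by
    linear_combination G 1 * a1 - wS r y 1 * g + G 1 * X * a0
  rw [k1, a0, k2]
  ring

theorem qw_odd (R : ℕ → ℤ → ℝ) (k : ℤ) (a : ℕ) : qWeight R k (2 * a + 1) =
    R a k * R (a + 1) (k + 1) / (R (a + 1) k * R a (k + 1)) := by
  have h : (2 * a + 1 + 1) / 2 = a + 1 := by omega
  simp [qWeight, h, show (2 * a + 1) % 2 = 1 by omega]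

theorem qw_even (R : ℕ → ℤ → ℝ) (k : ℤ) (a : ℕ) : qWeight R k (2 * (a + 1)) =
    R a k * R (a + 2) (k + 1) / (R (a + 1) k * R (a + 1) (k + 1)) := by
  have h : (2 * (a + 1)) / 2 = a + 1 := by omega
  simp only [qWeight, h, show ¬ (2 * (a + 1)) % 2 = 1 by omega, if_false]
  simp

theorem shift_q (r : ℕ) (hr : 1 ≤ r) (R : ℕ → ℤ → ℝ)
    (hpos : ∀ α, α ≤ r + 1 → ∀ n : ℤ, 0 < R α n)
    (hbd0 : ∀ n : ℤ, R 0 n = 1) (hbd1 : ∀ n : ℤ, R (r + 1) n = 1)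
    (hQ : ∀ α, 1 ≤ α → α ≤ r → ∀ n : ℤ,
      R α (n + 1) * R α (n - 1) = R α n ^ 2 + R (α + 1) n * R (α - 1) n) (m : ℤ) :
    wS r (qWeight R m) 0 = 1 + PowerSeries.X ^ 2 *
      (PowerSeries.C (qWeight R m 1) * wS r (qWeight R (m + 1)) 0) := by
  have hne : ∀ α, α ≤ r + 1 → ∀ n : ℤ, R α n ≠ 0 := fun α h n => (hpos α h n).ne'
  have hc : ∀ k, k + 1 ≤ r → R k m * R (k + 1) (m + 2) / (R (k + 1) (m + 1) * R k (m + 1)) =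
      qWeight R m (2 * k + 1) + qWeight R m (2 * (k + 1)) := by
    intro k hk
    have q := hQ (k + 1) (by omega) hk (m + 1)
    rw [show m + 1 + 1 = m + 2 by ring, show m + 1 - 1 = m by ring] at q
    simp only [Nat.add_sub_cancel, show k + 1 + 1 = k + 2 by omega] at q
    rw [qw_odd, qw_even]
    have n1 := hne k (by omega) (m + 1)
    have n2 := hne (k + 1) (by omega) (m + 1)
    have n3 := hne (k + 1) (by omega) m
    field_simp
    linear_combination R k m * q
  have hc' : ∀ k, k + 1 ≤ r → qWeight R (m + 1) (2 * (k + 1)) +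
      qWeight R (m + 1) (2 * (k + 1) + 1) =
      R (k + 1) m * R (k + 2) (m + 2) / (R (k + 2) (m + 1) * R (k + 1) (m + 1)) := by
    intro k hk
    have q := hQ (k + 1) (by omega) hk (m + 1)
    rw [show m + 1 + 1 = m + 2 by ring, show m + 1 - 1 = m by ring] at q
    simp only [Nat.add_sub_cancel, show k + 1 + 1 = k + 2 by omega] at q
    rw [qw_odd, qw_even]
    simp only [show k + 1 + 1 = k + 2 by omega, show m + 1 + 1 = m + 2 by ring]
    have n2 := hne (k + 1) (by omega) (m + 1)
    have n3 := hne (k + 1) (by omega) (m + 2)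
    have n4 := hne (k + 2) (by omega) (m + 1)
    field_simp
    linear_combination -R (k + 2) (m + 2) * q
  refine shift_identity r hr _ _
    (fun k => R (k - 1) m * R k (m + 2) / (R k (m + 1) * R (k - 1) (m + 1))) ?_ ?_ ?_ ?_ ?_
  · intro k h1 h2
    obtain ⟨k, rfl⟩ : ∃ j, k = j + 1 := ⟨k - 1, by omega⟩
    simpa [show 2 * (k + 1) - 1 = 2 * k + 1 by omega] using hc k h2
  · simp [qw_odd, hbd1]
  · have := qw_odd R (m + 1) 0
    simp only [mul_zero, zero_add] at this
    rw [this]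
    simp [hbd0, show m + 1 + 1 = m + 2 by ring]
  · intro k h1 h2
    obtain ⟨k, rfl⟩ : ∃ j, k = j + 1 := ⟨k - 1, by omega⟩
    simp only [show 2 * (k + 1) - 1 = 2 * k + 1 by omega, Nat.add_sub_cancel]
    rw [qw_odd, qw_odd]
    simp only [show k + 1 + 1 = k + 2 by omega, show m + 1 + 1 = m + 2 by ring]
    have n1 := hne k (by omega) (m + 1)
    have n2 := hne (k + 1) (by omega) (m + 1)
    have n3 := hne (k + 1) (by omega) m
    have n4 := hne (k + 1) (by omega) (m + 2)
    have n5 := hne (k + 2) (by omega) (m + 1)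
    field_simp
  · intro k h1 h2
    obtain ⟨k, rfl⟩ : ∃ j, k = j + 1 := ⟨k - 1, by omega⟩
    simpa using hc' k h2

theorem coeff_q (r : ℕ) (hr : 1 ≤ r) (R : ℕ → ℤ → ℝ)
    (hpos : ∀ α, α ≤ r + 1 → ∀ n : ℤ, 0 < R α n)
    (hbd0 : ∀ n : ℤ, R 0 n = 1) (hbd1 : ∀ n : ℤ, R (r + 1) n = 1)
    (hQ : ∀ α, 1 ≤ α → α ≤ r → ∀ n : ℤ,
      R α (n + 1) * R α (n - 1) = R α n ^ 2 + R (α + 1) n * R (α - 1) n) (n : ℕ) :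
    ∀ m : ℤ, R 1 (m + n) = R 1 m * PowerSeries.coeff (2 * n) (wS r (qWeight R m) 0) := by
  induction n with
  | zero =>
    intro m
    simp [wS]
  | succ n ih =>
    intro m
    rw [shift_q r hr R hpos hbd0 hbd1 hQ m, show 2 * (n + 1) = 2 * n + 2 by ring, map_add,
      PowerSeries.coeff_X_pow_mul, PowerSeries.coeff_C_mul, PowerSeries.coeff_one,
      if_neg (by omega), zero_add]
    have h := ih (m + 1)
    have w := qw_odd R m 0
    simp only [mul_zero, zero_add, hbd0, one_mul, mul_one] at w
    rw [w, show m + ((n + 1 : ℕ) : ℤ) = m + 1 + n by push_cast; ring, h]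
    have n1 := (hpos 1 (by omega) m).ne'
    field_simp

/-- R_{1,n}/R_{1,0} is the partition function of weighted paths
of 2n steps on the dual graph from vertex 0 to itself, i.e.
R_{1,n} = R_{1,0}·(M^{2n})_{0,0} where M = T_r(y(0)) (t = 1). -/
theorem qsystem_R1_path_partition_function (r : ℕ) (hr : 1 ≤ r) (R : ℕ → ℤ → ℝ)
    (hpos : ∀ α, α ≤ r + 1 → ∀ n : ℤ, 0 < R α n)
    (hbd0 : ∀ n : ℤ, R 0 n = 1) (hbd1 : ∀ n : ℤ, R (r + 1) n = 1)
    (hQ : ∀ α, 1 ≤ α → α ≤ r → ∀ n : ℤ,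
      R α (n + 1) * R α (n - 1) = R α n ^ 2 + R (α + 1) n * R (α - 1) n) :
    ∀ n : ℕ, R 1 (n : ℤ) =
      R 1 0 * ((Tmat r 1 (qWeight R 0)) ^ (2 * n)) ⟨0, by omega⟩ ⟨0, by omega⟩ := by
  intro n
  have h := coeff_q r hr R hpos hbd0 hbd1 hQ n 0
  simpa [wS] using h
end

section
/- Let (R_{α,n}) be an A_r Q-system solution with weight vector y(0), and let M be the transfer matrix T_r(t·y(0)) evaluated at t = 1. Then for every 1 ≤ α ≤ r+1 and every integer n ≥ α−1, R_{α,n} = (R_{1,0})^α · det_{1≤i,j≤α} ((M^{2(n+i+j−α−1)})_{0,0}). -/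
/-- Desnanot–Jacobi identity, when the central minor is nonzero. -/
lemma desnanot {n : ℕ} (A : Matrix (Fin (n + 2)) (Fin (n + 2)) ℝ)
    (hC : (A.submatrix (fun i : Fin n => i.castSucc.succ) (fun i : Fin n => i.castSucc.succ)).det ≠ 0) :
    A.det * (A.submatrix (fun i : Fin n => i.castSucc.succ) (fun i : Fin n => i.castSucc.succ)).det
      = (A.submatrix Fin.succ Fin.succ).det * (A.submatrix Fin.castSucc Fin.castSucc).det
        - (A.submatrix Fin.succ Fin.castSucc).det * (A.submatrix Fin.castSucc Fin.succ).det := by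
  classical
  set c : Fin n → Fin (n + 2) := fun i => i.castSucc.succ with hc
  set C := A.submatrix c c with hCdef
  let _ : Invertible C := Matrix.invertibleOfIsUnitDet C (isUnit_iff_ne_zero.mpr hC)
  let s : Fin (n + 2) → Fin (n + 2) → ℝ := fun p q =>
    A p q - ∑ j, (∑ i, A p (c i) * (⅟C) i j) * A (c j) q
  -- bordered determinants
  have hb : ∀ p q : Fin (n + 2),
      (A.submatrix (Sum.elim c (fun _ : Fin 1 => p)) (Sum.elim c (fun _ : Fin 1 => q))).det
        = C.det * s p q := by
    intro p q
    have : A.submatrix (Sum.elim c (fun _ : Fin 1 => p)) (Sum.elim c (fun _ : Fin 1 => q))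
        = Matrix.fromBlocks C (A.submatrix c (fun _ : Fin 1 => q))
          (A.submatrix (fun _ : Fin 1 => p) c)
          (A.submatrix (fun _ : Fin 1 => p) (fun _ : Fin 1 => q)) := by
      ext i j
      rcases i with i | i <;> rcases j with j | j <;> simp [C]
    rw [this, Matrix.det_fromBlocks₁₁, Matrix.det_fin_one]
    simp [s, Matrix.mul_apply]
  obtain ⟨b, hb0, hb1⟩ : ∃ b : Fin 2 → Fin (n + 2), b 0 = Fin.last (n + 1) ∧ b 1 = 0 :=
    ⟨![Fin.last (n + 1), 0], rfl, rfl⟩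
  have hinj : Function.Injective (Sum.elim c b : Fin n ⊕ Fin 2 → Fin (n + 2)) := by
    rintro (i | i) (j | j) h
    · simp [c, Fin.ext_iff] at h; simp [Fin.ext_iff, h]
    · exfalso; fin_cases j <;> simp [c, Fin.ext_iff, hb0, hb1] at h; omega
    · exfalso; fin_cases i <;> simp [c, Fin.ext_iff, hb0, hb1] at h; omega
    · fin_cases i <;> fin_cases j <;> simp [Fin.ext_iff, hb0, hb1] at h ⊢
  let e : Fin n ⊕ Fin 2 ≃ Fin (n + 2) := Equiv.ofBijective _
    ((Fintype.bijective_iff_injective_and_card _).mpr ⟨hinj, by simp⟩)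
  have hfull : A.det = C.det * (s (Fin.last (n+1)) (Fin.last (n+1)) * s 0 0
      - s (Fin.last (n+1)) 0 * s 0 (Fin.last (n+1))) := by
    rw [← Matrix.det_submatrix_equiv_self e A]
    have : A.submatrix e e
        = Matrix.fromBlocks C (A.submatrix c b)
          (A.submatrix b c)
          (A.submatrix b b) := by
      ext i j
      rcases i with i | i <;> rcases j with j | j <;> simp [C, e]
    rw [this, Matrix.det_fromBlocks₁₁, Matrix.det_fin_two]
    simp [s, Matrix.mul_apply, hb0, hb1]
  have hinj1 : Function.Injective (Sum.elim Fin.castSucc (fun _ => Fin.last n) :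
      Fin n ⊕ Fin 1 → Fin (n + 1)) := by
    rintro (i | i) (j | j) h
    · simp [Fin.ext_iff] at h; simp [Fin.ext_iff, h]
    · exfalso; simp [Fin.ext_iff] at h; omega
    · exfalso; simp [Fin.ext_iff] at h; omega
    · rw [Subsingleton.elim i j]
  have hinj2 : Function.Injective (Sum.elim Fin.succ (fun _ => 0) :
      Fin n ⊕ Fin 1 → Fin (n + 1)) := by
    rintro (i | i) (j | j) h
    · simp [Fin.ext_iff] at h; simp [Fin.ext_iff, h]
    · exfalso; simp [Fin.ext_iff] at h
    · exfalso; simp [Fin.ext_iff] at h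
    · rw [Subsingleton.elim i j]
  let e1 : Fin n ⊕ Fin 1 ≃ Fin (n + 1) := Equiv.ofBijective _
    ((Fintype.bijective_iff_injective_and_card _).mpr ⟨hinj1, by simp⟩)
  let e2 : Fin n ⊕ Fin 1 ≃ Fin (n + 1) := Equiv.ofBijective _
    ((Fintype.bijective_iff_injective_and_card _).mpr ⟨hinj2, by simp⟩)
  have he1 : Fin.succ ∘ e1 = Sum.elim c (fun _ : Fin 1 => Fin.last (n + 1)) := by
    funext i; rcases i with i | i <;> simp [e1, c]
  have he2 : Fin.castSucc ∘ e2 = Sum.elim c (fun _ : Fin 1 => (0 : Fin (n + 2))) := by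
    funext i; rcases i with i | i <;> simp [e2, c]
  have hss : (A.submatrix Fin.succ Fin.succ).det = C.det * s (Fin.last (n+1)) (Fin.last (n+1)) := by
    rw [← Matrix.det_submatrix_equiv_self e1, Matrix.submatrix_submatrix, he1, hb]
  have hcc : (A.submatrix Fin.castSucc Fin.castSucc).det = C.det * s 0 0 := by
    rw [← Matrix.det_submatrix_equiv_self e2, Matrix.submatrix_submatrix, he2, hb]
  let σ : Equiv.Perm (Fin (n + 1)) := e1.symm.trans e2
  have hσ : ⇑σ ∘ e1 = e2 := by funext i; simp [σ]
  have hsc : ((Equiv.Perm.sign σ : ℤˣ) : ℝ) * (A.submatrix Fin.succ Fin.castSucc).det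
      = C.det * s (Fin.last (n+1)) 0 := by
    rw [← Matrix.det_permute', ← Matrix.det_submatrix_equiv_self e1, Matrix.submatrix_submatrix,
      Matrix.submatrix_submatrix, ← hb, ← he1, ← he2, ← hσ]
    rfl
  have hcs : ((Equiv.Perm.sign σ : ℤˣ) : ℝ) * (A.submatrix Fin.castSucc Fin.succ).det
      = C.det * s 0 (Fin.last (n+1)) := by
    rw [← Matrix.det_permute, ← Matrix.det_submatrix_equiv_self e1, Matrix.submatrix_submatrix,
      Matrix.submatrix_submatrix, ← hb, ← he1, ← he2, ← hσ]
    rfl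
  have hsq : (((Equiv.Perm.sign σ : ℤˣ) : ℤ) : ℝ) * ((Equiv.Perm.sign σ : ℤˣ) : ℝ) = 1 := by
    rcases Int.units_eq_one_or (Equiv.Perm.sign σ) with h | h <;> simp [h]
  rw [hfull, hss, hcc]
  linear_combination (-(A.submatrix Fin.succ Fin.castSucc).det * (A.submatrix Fin.castSucc Fin.succ).det) * hsq
    + (((Equiv.Perm.sign σ : ℤˣ) : ℝ) * (A.submatrix Fin.castSucc Fin.succ).det) * hsc
    + C.det * s (Fin.last (n+1)) 0 * hcs

/-- Hankel determinants. -/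
noncomputable def hankelD (f : ℤ → ℝ) (α : ℕ) (n : ℤ) : ℝ :=
  Matrix.det (Matrix.of fun i j : Fin α => f (n + (i : ℕ) + (j : ℕ) + 1 - α))

lemma hankelD_rec (f : ℤ → ℝ) (α : ℕ) (n : ℤ) (h : hankelD f α n ≠ 0) :
    hankelD f (α + 2) n * hankelD f α n =
      hankelD f (α + 1) (n + 1) * hankelD f (α + 1) (n - 1) - hankelD f (α + 1) n ^ 2 := by
  set A : Matrix (Fin (α + 2)) (Fin (α + 2)) ℝ :=
    Matrix.of fun i j => f (n + (i : ℕ) + (j : ℕ) + 1 - (α + 2 : ℕ)) with hA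
  have h0 : hankelD f α n =
      (A.submatrix (fun i : Fin α => i.castSucc.succ) (fun i : Fin α => i.castSucc.succ)).det := by
    unfold hankelD; congr 1; ext i j; simp [A]; congr 1; ring
  have h1 : hankelD f (α + 1) (n + 1) = (A.submatrix Fin.succ Fin.succ).det := by
    unfold hankelD; congr 1; ext i j; simp [A]; congr 1; ring
  have h2 : hankelD f (α + 1) (n - 1) = (A.submatrix Fin.castSucc Fin.castSucc).det := by
    unfold hankelD; congr 1; ext i j; simp [A]; congr 1; ring
  have h3 : hankelD f (α + 1) n = (A.submatrix Fin.succ Fin.castSucc).det := by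
    unfold hankelD; congr 1; ext i j; simp [A]; congr 1; ring
  have h4 : hankelD f (α + 1) n = (A.submatrix Fin.castSucc Fin.succ).det := by
    unfold hankelD; congr 1; ext i j; simp [A]; congr 1; ring
  rw [sq]
  nth_rewrite 2 [h4]
  rw [h3, h1, h2, h0]
  rw [h0] at h
  exact desnanot A h

lemma R_eq_hankelD (r : ℕ) (R : ℕ → ℤ → ℝ)
    (hpos : ∀ α, α ≤ r + 1 → ∀ n : ℤ, 0 < R α n)
    (hbd0 : ∀ n : ℤ, R 0 n = 1)
    (hQ : ∀ α, 1 ≤ α → α ≤ r → ∀ n : ℤ,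
      R α (n + 1) * R α (n - 1) = R α n ^ 2 + R (α + 1) n * R (α - 1) n) :
    ∀ α, α ≤ r + 1 → ∀ n : ℤ, R α n = hankelD (R 1) α n := by
  intro α
  induction α using Nat.strong_induction_on with
  | _ α ih =>
    intro hα n
    match α, ih, hα with
    | 0, _, _ => simp [hankelD, hbd0]
    | 1, _, _ => simp [hankelD]
    | a + 2, ih, hα =>
      have e0 := ih a (by omega) (by omega)
      have e1 := ih (a + 1) (by omega) (by omega)
      have hp := hpos a (by omega) n
      have := hankelD_rec (R 1) a n (by rw [← e0]; exact hp.ne')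
      rw [← e0, ← e1, ← e1, ← e1] at this
      have q := hQ (a + 1) (by omega) (by omega) n
      simp only [Nat.add_sub_cancel] at q
      apply mul_right_cancel₀ hp.ne'
      rw [this]
      linear_combination -q

/-- Path counts. -/
noncomputable def Vp (y : ℕ → ℝ) : ℕ → ℕ → ℝ
  | 0, _ => 1
  | n + 1, k => ∑ j ∈ Finset.range k,
      (y (2 * j + 1) * Vp y n (j + 1) + y (2 * j + 2) * Vp y n (j + 2))

lemma Vp_zero (y : ℕ → ℝ) (k : ℕ) : Vp y 0 k = 1 := by simp [Vp]

lemma Vp_succ_zero (y : ℕ → ℝ) (n : ℕ) : Vp y (n + 1) 0 = 0 := by simp [Vp]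

lemma Vp_succ (y : ℕ → ℝ) (n k : ℕ) : Vp y (n + 1) (k + 1) = Vp y (n + 1) k +
    (y (2 * k + 1) * Vp y n (k + 1) + y (2 * k + 2) * Vp y n (k + 2)) := by
  simp only [Vp, Finset.sum_range_succ]

lemma Vp_shift (y z : ℕ → ℝ) (hz : z 0 = 0)
    (h1 : ∀ k, y (2 * k + 1) + y (2 * k + 2) = z (2 * k) + z (2 * k + 1))
    (h2 : ∀ k, y (2 * k + 2) * z (2 * k + 3) = y (2 * k + 1) * z (2 * k + 2)) :
    ∀ n k, Vp y (n + 1) (k + 1) = Vp z (n + 1) k + z (2 * k + 1) * Vp z n (k + 1) := by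
  intro n
  induction n with
  | zero =>
    intro k
    induction k with
    | zero =>
      rw [Vp_succ, Vp_succ_zero, Vp_succ_zero]
      simp only [Vp_zero]
      have := h1 0
      simp only [mul_zero, zero_add] at this ⊢
      linear_combination this + hz
    | succ k ihk =>
      rw [Vp_succ, ihk, Vp_succ z]
      simp only [Vp_zero]
      have := h1 (k + 1)
      simp only [show 2 * (k + 1) = 2 * k + 2 by ring] at this ⊢
      linear_combination this
  | succ n ihn =>
    intro k
    induction k with
    | zero =>
      rw [Vp_succ, Vp_succ_zero, Vp_succ_zero, ihn, ihn, Vp_succ_zero]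
      have a := h1 0
      have b := h2 0
      have c := Vp_succ z n 0
      rw [Vp_succ_zero] at c
      simp only [mul_zero, zero_add, mul_one] at a b c ⊢
      linear_combination (Vp z (n + 1) 1) * (a + hz) + (Vp z n 2) * b - y 1 * c
    | succ k ihk =>
      rw [Vp_succ, ihk, Vp_succ z (n + 1) k, ihn, ihn]
      have a := h1 (k + 1)
      have b := h2 (k + 1)
      have c := Vp_succ z n (k + 1)
      simp only [show 2 * (k + 1) = 2 * k + 2 by ring, show 2 * (k + 1 + 1) = 2 * k + 4 by ring,
        add_assoc, Nat.reduceAdd] at a b c ⊢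
      linear_combination (Vp z (n + 1) (k + 2)) * a + (Vp z n (k + 3)) * b - y (2 * k + 3) * c

/-- Truncated weights. -/
noncomputable def Yw (r : ℕ) (R : ℕ → ℤ → ℝ) (k : ℤ) (a : ℕ) : ℝ :=
  if a = 0 ∨ 2 * r + 1 < a then 0 else qWeight R k a

lemma Yw_odd (r : ℕ) (R : ℕ → ℤ → ℝ) (k : ℤ) (j : ℕ) (hj : j ≤ r) :
    Yw r R k (2 * j + 1) = R j k * R (j + 1) (k + 1) / (R (j + 1) k * R j (k + 1)) := by
  unfold Yw qWeight
  rw [if_neg (by omega), if_pos (by omega)]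
  simp [show (2 * j + 1 + 1) / 2 = j + 1 by omega]

lemma Yw_even (r : ℕ) (R : ℕ → ℤ → ℝ) (k : ℤ) (j : ℕ) (hj : j < r) :
    Yw r R k (2 * j + 2) = R j k * R (j + 2) (k + 1) / (R (j + 1) k * R (j + 1) (k + 1)) := by
  unfold Yw qWeight
  rw [if_neg (by omega), if_neg (by omega)]
  simp [show (2 * j + 2) / 2 = j + 1 by omega]

lemma Yw_big (r : ℕ) (R : ℕ → ℤ → ℝ) (k : ℤ) (a : ℕ) (h : 2 * r + 1 < a) :
    Yw r R k a = 0 := by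
  unfold Yw; rw [if_pos (Or.inr h)]

lemma Yw_h2 (r : ℕ) (R : ℕ → ℤ → ℝ)
    (hpos : ∀ α, α ≤ r + 1 → ∀ n : ℤ, 0 < R α n) (m : ℤ) (k : ℕ) :
    Yw r R m (2 * k + 2) * Yw r R (m + 1) (2 * k + 3)
      = Yw r R m (2 * k + 1) * Yw r R (m + 1) (2 * k + 2) := by
  by_cases hk : k < r
  · rw [Yw_even _ _ _ _ hk, Yw_even _ _ _ _ hk, Yw_odd _ _ _ _ (by omega),
      show 2 * k + 3 = 2 * (k + 1) + 1 by ring, Yw_odd _ _ _ _ (by omega)]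
    have a1 := (hpos k (by omega) (m + 1)).ne'
    have a2 := (hpos (k + 1) (by omega) (m + 1)).ne'
    have a3 := (hpos (k + 2) (by omega) (m + 1)).ne'
    have a4 := (hpos (k + 1) (by omega) (m + 1 + 1)).ne'
    have a5 := (hpos (k + 1) (by omega) m).ne'
    simp only [show k + 1 + 1 = k + 2 from rfl]
    field_simp
  · rw [Yw_big _ _ _ (2 * k + 2) (by omega), Yw_big _ _ _ (2 * k + 2) (by omega)]; ring

lemma Yw_h1 (r : ℕ) (hr : 1 ≤ r) (R : ℕ → ℤ → ℝ)
    (hpos : ∀ α, α ≤ r + 1 → ∀ n : ℤ, 0 < R α n)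
    (hbd0 : ∀ n : ℤ, R 0 n = 1) (hbd1 : ∀ n : ℤ, R (r + 1) n = 1)
    (hQ : ∀ α, 1 ≤ α → α ≤ r → ∀ n : ℤ,
      R α (n + 1) * R α (n - 1) = R α n ^ 2 + R (α + 1) n * R (α - 1) n) (m : ℤ) (k : ℕ) :
    Yw r R m (2 * k + 1) + Yw r R m (2 * k + 2)
      = Yw r R (m + 1) (2 * k) + Yw r R (m + 1) (2 * k + 1) := by
  by_cases hk : r < k
  · rw [Yw_big, Yw_big, Yw_big, Yw_big] <;> omega
  push Not at hk
  have left : Yw r R m (2 * k + 1) + Yw r R m (2 * k + 2)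
      = R k m * R (k + 1) (m + 1 + 1) / (R k (m + 1) * R (k + 1) (m + 1)) := by
    rw [Yw_odd _ _ _ _ hk]
    have a1 := (hpos k (by omega) (m + 1)).ne'
    have a2 := (hpos (k + 1) (by omega) (m + 1)).ne'
    have a5 := (hpos (k + 1) (by omega) m).ne'
    rcases Nat.lt_or_ge k r with h | h
    · rw [Yw_even _ _ _ _ h]
      have q := hQ (k + 1) (by omega) (by omega) (m + 1)
      simp only [Nat.add_sub_cancel, add_sub_cancel_right, show k + 1 + 1 = k + 2 from rfl] at q
      field_simp
      linear_combination -(R k m) * q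
    · obtain rfl : k = r := by omega
      rw [Yw_big _ _ _ _ (by omega)]
      simp [hbd1]
  have right : Yw r R (m + 1) (2 * k) + Yw r R (m + 1) (2 * k + 1)
      = R k m * R (k + 1) (m + 1 + 1) / (R k (m + 1) * R (k + 1) (m + 1)) := by
    rw [Yw_odd _ _ _ _ hk]
    rcases k with _ | k
    · simp [Yw, hbd0]
    · rw [show 2 * (k + 1) = 2 * k + 2 by ring, Yw_even _ _ _ _ (by omega)]
      have a1 := (hpos (k + 1) (by omega) (m + 1)).ne'
      have a2 := (hpos (k + 2) (by omega) (m + 1)).ne'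
      have a5 := (hpos (k + 1) (by omega) (m + 1 + 1)).ne'
      have q := hQ (k + 1) (by omega) (by omega) (m + 1)
      simp only [Nat.add_sub_cancel, add_sub_cancel_right, show k + 1 + 1 = k + 2 from rfl] at q ⊢
      field_simp
      linear_combination -(R (k + 2) (m + 1 + 1)) * q
  rw [left, right]

lemma R1_eq (r : ℕ) (hr : 1 ≤ r) (R : ℕ → ℤ → ℝ)
    (hpos : ∀ α, α ≤ r + 1 → ∀ n : ℤ, 0 < R α n)
    (hbd0 : ∀ n : ℤ, R 0 n = 1) (hbd1 : ∀ n : ℤ, R (r + 1) n = 1)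
    (hQ : ∀ α, 1 ≤ α → α ≤ r → ∀ n : ℤ,
      R α (n + 1) * R α (n - 1) = R α n ^ 2 + R (α + 1) n * R (α - 1) n) :
    ∀ (n : ℕ) (m : ℤ), R 1 m * (Yw r R m 1 * Vp (Yw r R m) n 1) = R 1 (m + n + 1) := by
  have hy : ∀ m, R 1 m * Yw r R m 1 = R 1 (m + 1) := by
    intro m
    have := Yw_odd r R m 0 (by omega)
    simp only [mul_zero, zero_add, hbd0] at this
    rw [this]
    have := (hpos 1 (by omega) m).ne'
    field_simp
  intro n
  induction n with
  | zero => intro m; simp [Vp_zero, hy]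
  | succ n ih =>
    intro m
    have := Vp_shift (Yw r R m) (Yw r R (m + 1)) (by simp [Yw])
      (Yw_h1 r hr R hpos hbd0 hbd1 hQ m) (Yw_h2 r R hpos m) n 0
    simp only [mul_zero, zero_add, Vp_succ_zero] at this
    rw [this, ← mul_assoc, hy, ih]
    congr 1; push_cast; ring

/-- Entries at the spine vertices. -/
noncomputable def Xp (y : ℕ → ℝ) (m k : ℕ) : ℝ :=
  if k ≤ m ∧ (m - k) % 2 = 0 then Vp y ((m - k) / 2) k else 0

/-- Entries at the leaf vertices. -/
noncomputable def Xl (y : ℕ → ℝ) (m k : ℕ) : ℝ :=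
  if m = 0 then 0 else Xp y (m - 1) k

/-- Entries of the first column of the powers of the transfer matrix. -/
noncomputable def gcol (y : ℕ → ℝ) (m p : ℕ) : ℝ :=
  if p = 0 then (if m = 0 then 1 else y 1 * Xp y (m - 1) 1)
  else if p = 1 then Xp y m 1
  else if p % 2 = 0 then Xp y m (p / 2 + 1)
  else Xl y m ((p + 1) / 2)

lemma Xp_rec (y : ℕ → ℝ) (m k : ℕ) (hk : 1 ≤ k) :
    Xp y (m + 1) (k + 1) = Xp y m k + y (2 * k + 1) * Xl y m (k + 1)
      + y (2 * k + 2) * Xp y m (k + 2) := by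
  rcases Nat.lt_or_ge m k with h | h
  · unfold Xl Xp
    rw [if_neg (by omega), if_neg (by omega), if_neg (c := k + 2 ≤ m ∧ _) (by omega)]
    split_ifs <;> first | omega | simp
  obtain ⟨d, rfl⟩ := Nat.exists_eq_add_of_le h
  rcases Nat.even_or_odd' d with ⟨n, rfl | rfl⟩
  · rcases n with _ | n
    · unfold Xl Xp
      rw [if_pos (by omega), if_pos (by omega), if_neg (c := k + 2 ≤ _ ∧ _) (by omega)]
      rw [if_neg (by omega), if_neg (by omega)]
      simp [Vp_zero]
    · unfold Xl Xp
      rw [if_pos (by omega), if_pos (by omega), if_pos (c := k + 2 ≤ _ ∧ _) (by omega)]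
      rw [if_neg (by omega), if_pos (by omega)]
      rw [show (k + 2 * (n + 1) + 1 - (k + 1)) / 2 = n + 1 by omega,
        show (k + 2 * (n + 1) - k) / 2 = n + 1 by omega,
        show (k + 2 * (n + 1) - 1 - (k + 1)) / 2 = n by omega,
        show (k + 2 * (n + 1) - (k + 2)) / 2 = n by omega, Vp_succ]
      ring
  · unfold Xl Xp
    rw [if_neg (by omega), if_neg (by omega), if_neg (c := k + 2 ≤ _ ∧ _) (by omega)]
    rw [if_neg (by omega), if_neg (by omega)]
    simp

lemma Xp_rec_one (y : ℕ → ℝ) (m : ℕ) :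
    Xp y (m + 1) 1 = gcol y m 0 + y 2 * Xp y m 2 := by
  rcases Nat.even_or_odd' m with ⟨n, rfl | rfl⟩
  · rcases n with _ | n
    · simp [gcol, Xp, Vp_zero]
    · unfold gcol Xp
      rw [if_pos (by omega), if_pos rfl, if_neg (by omega), if_pos (by omega), if_pos (by omega)]
      rw [show (2 * (n + 1) + 1 - 1) / 2 = n + 1 by omega,
        show (2 * (n + 1) - 1 - 1) / 2 = n by omega,
        show (2 * (n + 1) - 2) / 2 = n by omega, Vp_succ, Vp_succ_zero]
      simp
  · unfold gcol Xp
    rw [if_neg (by omega), if_pos rfl, if_neg (by omega), if_neg (by omega), if_neg (by omega)]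
    simp

lemma Tmat_mul (r : ℕ) (hr : 1 ≤ r) (w y : ℕ → ℝ) (hw : ∀ a, 1 ≤ a → a ≤ 2 * r + 1 → w a = y a)
    (hy : y (2 * r + 2) = 0) (m : ℕ) (p : Fin (2 * r + 2)) :
    ∑ q, Tmat r 1 w p q * gcol y m q = gcol y (m + 1) p := by
  obtain ⟨p, hp⟩ := p
  have key : ∀ T : ℕ → ℝ, (∀ q : Fin (2 * r + 2), Tmat r 1 w ⟨p, hp⟩ q = T q) →
      ∑ q, Tmat r 1 w ⟨p, hp⟩ q * gcol y m q = ∑ q ∈ Finset.range (2 * r + 2), T q * gcol y m q := by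
    intro T hT
    rw [← Fin.sum_univ_eq_sum_range (fun q => T q * gcol y m q)]
    exact Finset.sum_congr rfl fun q _ => by rw [hT]
  rcases Nat.even_or_odd' p with ⟨k, rfl | rfl⟩
  · rcases k with _ | k
    · rw [key (fun q => if q = 1 then y 1 else 0)]
      · simp only [ite_mul, zero_mul, Finset.sum_ite_eq', Finset.mem_range]
        rw [if_pos (by omega)]
        simp [gcol]
      · rintro ⟨q, hq⟩
        have := hw 1 (by omega) (by omega)
        simp only [Tmat, Matrix.of_apply]
        split_ifs <;> first | omega | simp_all
    · have h2k : 2 * (k + 1) ≤ 2 * r := by omega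
      rw [key (fun q => (if q = (if k = 0 then 1 else 2 * k) then 1 else 0)
        + (if q = 2 * k + 3 then y (2 * k + 3) else 0)
        + (if q = 2 * k + 4 then y (2 * k + 4) else 0))]
      · simp only [add_mul, Finset.sum_add_distrib, ite_mul, zero_mul, one_mul,
          Finset.sum_ite_eq', Finset.mem_range]
        have hlast : (if 2 * k + 4 < 2 * r + 2 then y (2 * k + 4) * gcol y m (2 * k + 4) else 0)
            = y (2 * k + 4) * Xp y m (k + 3) := by
          split_ifs with h
          · unfold gcol
            rw [if_neg (by omega), if_neg (by omega), if_pos (by omega),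
              show (2 * k + 4) / 2 + 1 = k + 3 by omega]
          · rw [show 2 * k + 4 = 2 * r + 2 by omega, hy]; simp
        have hmid : gcol y m (2 * k + 3) = Xl y m (k + 2) := by
          unfold gcol
          rw [if_neg (by omega), if_neg (by omega), if_neg (by omega),
            show (2 * k + 3 + 1) / 2 = k + 2 by omega]
        have hfst : gcol y m (if k = 0 then 1 else 2 * k) = Xp y m (k + 1) := by
          split_ifs with h
          · subst h; simp [gcol]
          · unfold gcol
            rw [if_neg (by omega), if_neg (by omega), if_pos (by omega),
              show (2 * k) / 2 + 1 = k + 1 by omega]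
        have hres : gcol y (m + 1) (2 * (k + 1)) = Xp y (m + 1) (k + 2) := by
          unfold gcol
          rw [if_neg (by omega), if_neg (by omega), if_pos (by omega),
            show (2 * (k + 1)) / 2 + 1 = k + 2 by omega]
        rw [hlast, hmid, hfst, hres, if_pos (by split_ifs <;> omega), if_pos (by omega),
          Xp_rec y m (k + 1) (by omega)]
        simp only [show 2 * (k + 1) = 2 * k + 2 by ring]
      · rintro ⟨q, hq⟩
        have e1 := hw (2 * k + 3) (by omega) (by omega)
        have e2 : q = 2 * k + 4 → w (2 * k + 4) = y (2 * k + 4) :=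
          fun h => hw (2 * k + 4) (by omega) (by omega)
        simp only [Tmat, Matrix.of_apply, one_mul]
        rw [show 2 * (k + 1) + 1 = 2 * k + 3 by ring, show 2 * (k + 1) + 2 = 2 * k + 4 by ring]
        split_ifs <;> first | omega | simp_all
  · rcases k with _ | k
    · rw [key (fun q => (if q = 0 then 1 else 0) + (if q = 2 then y 2 else 0))]
      · simp only [add_mul, Finset.sum_add_distrib, ite_mul, zero_mul, one_mul,
          Finset.sum_ite_eq', Finset.mem_range]
        rw [if_pos (by omega), if_pos (by omega)]
        have := Xp_rec_one y m
        simp [gcol] at this ⊢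
        rw [this]
      · rintro ⟨q, hq⟩
        have := hw 2 (by omega) (by omega)
        simp only [Tmat, Matrix.of_apply]
        split_ifs <;> first | omega | simp_all
    · rw [key (fun q => (if q = 2 * k + 2 then 1 else 0))]
      · simp only [ite_mul, zero_mul, one_mul, Finset.sum_ite_eq', Finset.mem_range]
        rw [if_pos (by omega)]
        unfold gcol
        rw [if_neg (by omega), if_neg (by omega), if_pos (by omega), if_neg (by omega),
          if_neg (by omega), if_neg (by omega)]
        unfold Xl
        rw [if_neg (by omega)]
        congr 1; omega
      · rintro ⟨q, hq⟩
        simp only [Tmat, Matrix.of_apply]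
        split_ifs <;> first | omega | simp_all

lemma Tmat_pow (r : ℕ) (hr : 1 ≤ r) (w y : ℕ → ℝ) (hw : ∀ a, 1 ≤ a → a ≤ 2 * r + 1 → w a = y a)
    (hy : y (2 * r + 2) = 0) (m : ℕ) (p : Fin (2 * r + 2)) (h0 : 0 < 2 * r + 2) :
    (Tmat r 1 w ^ m) p ⟨0, h0⟩ = gcol y m p := by
  induction m generalizing p with
  | zero =>
    obtain ⟨p, hp⟩ := p
    simp only [pow_zero, Matrix.one_apply, Fin.mk.injEq]
    unfold gcol Xl Xp
    split_ifs <;> first | omega | rfl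
  | succ m ih =>
    rw [pow_succ', Matrix.mul_apply, ← Tmat_mul r hr w y hw hy]
    exact Finset.sum_congr rfl fun q _ => by rw [ih]

lemma R1_Tmat (r : ℕ) (hr : 1 ≤ r) (R : ℕ → ℤ → ℝ)
    (hpos : ∀ α, α ≤ r + 1 → ∀ n : ℤ, 0 < R α n)
    (hbd0 : ∀ n : ℤ, R 0 n = 1) (hbd1 : ∀ n : ℤ, R (r + 1) n = 1)
    (hQ : ∀ α, 1 ≤ α → α ≤ r → ∀ n : ℤ,
      R α (n + 1) * R α (n - 1) = R α n ^ 2 + R (α + 1) n * R (α - 1) n) (n : ℕ)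
    (h0 : 0 < 2 * r + 2) :
    R 1 (n : ℤ) = R 1 0 * ((Tmat r 1 (qWeight R 0)) ^ (2 * n)) ⟨0, h0⟩ ⟨0, h0⟩ := by
  rw [Tmat_pow r hr _ (Yw r R 0)
    (fun a h1 h2 => by unfold Yw; rw [if_neg (by omega)]) (Yw_big _ _ _ _ (by omega))]
  rcases n with _ | n
  · simp [gcol]
  · have := R1_eq r hr R hpos hbd0 hbd1 hQ n 0
    unfold gcol Xp
    rw [if_pos rfl, if_neg (by omega), if_pos (by omega),
      show (2 * (n + 1) - 1 - 1) / 2 = n by omega, this]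
    congr 1; push_cast; ring

/-- R_{α,n} = (R_{1,0})^α · det_{1≤i,j≤α} ((M^{2(n+i+j−α−1)})_{0,0})
where M = T_r(y(0)) (t = 1). -/
theorem qsystem_R_alpha_nonintersecting_paths (r : ℕ) (hr : 1 ≤ r) (R : ℕ → ℤ → ℝ)
    (hpos : ∀ α, α ≤ r + 1 → ∀ n : ℤ, 0 < R α n)
    (hbd0 : ∀ n : ℤ, R 0 n = 1) (hbd1 : ∀ n : ℤ, R (r + 1) n = 1)
    (hQ : ∀ α, 1 ≤ α → α ≤ r → ∀ n : ℤ,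
      R α (n + 1) * R α (n - 1) = R α n ^ 2 + R (α + 1) n * R (α - 1) n) :
    ∀ α, 1 ≤ α → α ≤ r + 1 → ∀ n : ℕ, α - 1 ≤ n →
      R α (n : ℤ) = R 1 0 ^ α * Matrix.det (Matrix.of fun i j : Fin α =>
        ((Tmat r 1 (qWeight R 0)) ^ (2 * (n + (i : ℕ) + (j : ℕ) + 1 - α)))
          ⟨0, by omega⟩ ⟨0, by omega⟩) := by
  intro α h1 hα n hn
  rw [R_eq_hankelD r R hpos hbd0 hQ α hα]
  have hcard : R 1 0 ^ α = R 1 0 ^ Fintype.card (Fin α) := by simp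
  unfold hankelD
  rw [hcard, ← Matrix.det_smul]
  congr 1
  ext i j
  simp only [Matrix.of_apply, Matrix.smul_apply, smul_eq_mul]
  rw [← R1_Tmat r hr R hpos hbd0 hbd1 hQ]
  congr 1
  omega
end

section
/- Let r ≥ 1 and let m = (m_1,…,m_r) ∈ ℤ^r be a Motzkin path, i.e. |m_{α+1} − m_α| ≤ 1 for 1 ≤ α ≤ r−1. Then for every 1 ≤ α ≤ r and every n ∈ ℤ there exist a polynomial P in 2r variables with nonnegative integer coefficients and a monomial M in the same 2r variables (both depending only on r, m, α, n) such that for every A_r Q-system solution (R_{β,j}), one has R_{α,n} = P(R_{1,m_1},…,R_{r,m_r}, R_{1,m_1+1},…,R_{r,m_r+1}) / M(R_{1,m_1},…,R_{r,m_r}, R_{1,m_1+1},…,R_{r,m_r+1}). In other words, every R_{α,n} is a Laurent polynomial with nonnegative integer coefficients in the seed variables {R_{β,m_β}, R_{β,m_β+1} : 1 ≤ β ≤ r}. -/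
namespace QSys
open Matrix

/-- identity matrix with row `p` replaced by `γ e_p + δ e_q` -/
noncomputable def T {r : ℕ} (p q : Fin (r+1)) (γ δ : ℝ) : Matrix (Fin (r+1)) (Fin (r+1)) ℝ :=
  1 + Matrix.single p p (γ - 1) + Matrix.single p q δ

noncomputable def V (r i : ℕ) (v b a : ℝ) : Matrix (Fin (r+1)) (Fin (r+1)) ℝ :=
  T (Fin.ofNat (r+1) i) (Fin.ofNat (r+1) (i+1)) (b / a) (v / a)

noncomputable def U (r i : ℕ) (a b u : ℝ) : Matrix (Fin (r+1)) (Fin (r+1)) ℝ :=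
  T (Fin.ofNat (r+1) (i+1)) (Fin.ofNat (r+1) i) (a / b) (u / b)

lemma e_ne {r i j : ℕ} (hi : i ≤ r) (hj : j ≤ r) (h : i ≠ j) :
    Fin.ofNat (r+1) i ≠ Fin.ofNat (r+1) j := by
  intro h'
  have := congrArg Fin.val h'
  simp only [Fin.ofNat, Nat.mod_eq_of_lt (Nat.lt_succ_of_le hi),
    Nat.mod_eq_of_lt (Nat.lt_succ_of_le hj)] at this
  exact h this

lemma T_comm {r : ℕ} {p q p' q' : Fin (r+1)} (γ δ γ' δ' : ℝ)
    (h1 : p ≠ p') (h2 : q ≠ p') (h3 : q' ≠ p) :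
    T p q γ δ * T p' q' γ' δ' = T p' q' γ' δ' * T p q γ δ := by
  simp only [T, mul_add, add_mul, one_mul, mul_one]
  rw [single_mul_single_of_ne _ _ _ _ h1, single_mul_single_of_ne _ _ _ _ h1,
    single_mul_single_of_ne _ _ _ _ h2, single_mul_single_of_ne _ _ _ _ h2,
    single_mul_single_of_ne _ _ _ _ h3, single_mul_single_of_ne _ _ _ _ h3,
    single_mul_single_of_ne _ _ _ _ h1.symm, single_mul_single_of_ne _ _ _ _ h1.symm]
  abel

lemma VU_comm {r i j : ℕ} (hij : i < j) (hj : j < r) (v b a a' b' u : ℝ) :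
    V r i v b a * U r j a' b' u = U r j a' b' u * V r i v b a := by
  apply T_comm <;> apply e_ne <;> omega

lemma VU_comm' {r i j : ℕ} (hij : i + 1 < j) (hj : j < r) (v b a a' b' u : ℝ) :
    V r j v b a * U r i a' b' u = U r i a' b' u * V r j v b a := by
  apply T_comm <;> apply e_ne <;> omega

lemma exch {r i : ℕ} (hi : i < r) {v α β γ u : ℝ} (hα : 0 < α) (hβ : 0 < β) (hγ : 0 < γ)
    (h : α * γ = β ^ 2 + u * v) :
    V r i v β α * U r i α β u = U r i β γ u * V r i v γ β := by
  have h1 : Fin.ofNat (r+1) i ≠ Fin.ofNat (r+1) (i+1) := by apply e_ne <;> omega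
  unfold V U
  generalize Fin.ofNat (r+1) i = p at *
  generalize Fin.ofNat (r+1) (i+1) = q at *
  simp only [T, mul_add, add_mul, one_mul, mul_one, single_mul_single_same]
  rw [single_mul_single_of_ne _ _ _ _ h1, single_mul_single_of_ne _ _ _ _ h1,
     single_mul_single_of_ne _ _ _ _ h1.symm, single_mul_single_of_ne _ _ _ _ h1.symm]
  have e1 : u * v = α * γ - β ^ 2 := by linarith
  clear h
  ext x y
  simp only [Matrix.add_apply, Matrix.single_apply, Matrix.zero_apply]
  by_cases hx : p = x <;> by_cases hy : p = y <;> by_cases hx' : q = x <;> by_cases hy' : q = y <;>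
    simp_all <;> field_simp <;> first | done | linear_combination e1 | linear_combination -e1 | linear_combination β * e1 | linear_combination -β * e1 | ring

lemma flip {r i : ℕ} (hi : i + 1 < r) {a b p q : ℝ} (ha : 0 < a) (hb : 0 < b) (hp : 0 < p) (hq : 0 < q) :
    V r (i+1) a p q * U r i a b q = U r i a b p * V r (i+1) b p q := by
  have h1 : Fin.ofNat (r+1) i ≠ Fin.ofNat (r+1) (i+1) := by apply e_ne <;> omega
  have h2 : Fin.ofNat (r+1) (i+1) ≠ Fin.ofNat (r+1) (i+1+1) := by apply e_ne <;> omega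
  have h3 : Fin.ofNat (r+1) i ≠ Fin.ofNat (r+1) (i+1+1) := by apply e_ne <;> omega
  unfold V U
  generalize Fin.ofNat (r+1) i = x at *
  generalize Fin.ofNat (r+1) (i+1) = y at *
  generalize Fin.ofNat (r+1) (i+1+1) = z at *
  simp only [T, mul_add, add_mul, one_mul, mul_one, single_mul_single_same]
  rw [single_mul_single_of_ne _ _ _ _ h2.symm, single_mul_single_of_ne _ _ _ _ h2.symm,
     single_mul_single_of_ne _ _ _ _ h1, single_mul_single_of_ne _ _ _ _ h1]
  ext s t
  simp only [Matrix.add_apply, Matrix.single_apply, Matrix.zero_apply]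
  by_cases hx : y = s <;> by_cases hy : x = t <;> by_cases hx' : y = t <;> by_cases hy' : z = t <;>
    simp_all <;> field_simp <;> first | done | ring

noncomputable def Bm (r : ℕ) (st : ℕ → ℤ) (a b : ℕ → ℝ) : ℕ → ℕ → ℝ →
    Matrix (Fin (r+1)) (Fin (r+1)) ℝ
  | 0, _, _ => 1
  | d+1, i, v => if st i = 1 then Bm r st a b d (i+1) (b i) * V r i v (b i) (a i)
      else V r i v (b i) (a i) * Bm r st a b d (i+1) (a i)

noncomputable def Lm (r : ℕ) (st : ℕ → ℤ) (a b : ℕ → ℝ) : ℕ → ℕ →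
    Matrix (Fin (r+1)) (Fin (r+1)) ℝ
  | 0, _ => 1
  | d+1, i => if st i = -1 then Lm r st a b d (i+1) * U r i (a i) (b i) (b (i+1))
      else U r i (a i) (b i) (a (i+1)) * Lm r st a b d (i+1)

lemma V_Lm {r : ℕ} (st : ℕ → ℤ) (a b : ℕ → ℝ) (x y z : ℝ) (k : ℕ) : ∀ d i, k < i → i + d = r →
    V r k x y z * Lm r st a b d i = Lm r st a b d i * V r k x y z := by
  intro d
  induction d with
  | zero => intro i _ _; simp [Lm]
  | succ d ih =>
    intro i hi hd
    have h1 := ih (i+1) (by omega) (by omega)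
    have h2 := fun u w t => VU_comm (r := r) hi (by omega) x y z u w t
    simp only [Lm]
    split_ifs
    · rw [← mul_assoc, h1, mul_assoc, h2, mul_assoc]
    · rw [← mul_assoc, h2, mul_assoc, h1, mul_assoc]

lemma Bm_U {r : ℕ} (st : ℕ → ℤ) (a b : ℕ → ℝ) (x y z : ℝ) (k : ℕ) : ∀ d i v, k + 1 < i → i + d = r →
    Bm r st a b d i v * U r k x y z = U r k x y z * Bm r st a b d i v := by
  intro d
  induction d with
  | zero => intro i v _ _; simp [Bm]
  | succ d ih =>
    intro i v hi hd
    have h1 := fun v => ih (i+1) v (by omega) (by omega)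
    have h2 := fun u w t => VU_comm' (r := r) hi (by omega) u w t x y z
    simp only [Bm]
    split_ifs
    · rw [mul_assoc, h2, ← mul_assoc, h1, mul_assoc]
    · rw [mul_assoc, h1, ← mul_assoc, h2, mul_assoc]

lemma flipB {r : ℕ} (st : ℕ → ℤ) (a b : ℕ → ℝ) (ha : ∀ i, 0 < a i) (hb : ∀ i, 0 < b i)
    (har : a r = 1) (hbr : b r = 1) (x y : ℝ) (hx : 0 < x) (hy : 0 < y) (d i : ℕ)
    (hd : i + 1 + d = r) :
    Bm r st a b d (i+1) x * U r i x y (a (i+1)) = U r i x y (b (i+1)) * Bm r st a b d (i+1) y := by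
  cases d with
  | zero =>
    have : i + 1 = r := by omega
    simp [Bm, this, har, hbr]
  | succ d =>
    have h1 := fun v u => Bm_U (r := r) st a b x y u i d (i+1+1) v (by omega) (by omega)
    have h2 := flip (r := r) (i := i) (by omega) hx hy (hb (i+1)) (ha (i+1))
    simp only [Bm]
    split_ifs
    · rw [mul_assoc, h2, ← mul_assoc, h1, mul_assoc]
    · rw [mul_assoc, h1, ← mul_assoc, h2, mul_assoc]

def un (st : ℕ → ℤ) (a b c : ℕ → ℝ) (i : ℕ) : ℝ :=
  if st i = 1 then a (i+1) else if st i = -1 then c (i+1) else b (i+1)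
def vn (st : ℕ → ℤ) (a b c : ℕ → ℝ) (i : ℕ) : ℝ :=
  if st i = 1 then c i else if st i = -1 then a i else b i

lemma BL {r : ℕ} (st : ℕ → ℤ) (a b c : ℕ → ℝ) (ha : ∀ i, 0 < a i) (hb : ∀ i, 0 < b i)
    (hc : ∀ i, 0 < c i) (har : a r = 1) (hbr : b r = 1) (hcr : c r = 1)
    (hE : ∀ i, i + 1 < r → a (i+1) * c (i+1) = b (i+1) ^ 2 + un st a b c (i+1) * vn st a b c i) :
    ∀ d i v, i + d = r → (0 < d → a i * c i = b i ^ 2 + un st a b c i * v) →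
      Bm r st a b d i v * Lm r st a b d i = Lm r st b c d i * Bm r st b c d i v := by
  intro d
  induction d with
  | zero => intro i v _ _; simp [Bm, Lm]
  | succ d ih =>
    intro i v hd hv
    have h0 := ih (i+1) (vn st a b c i) (by omega) (fun _ => hE i (by omega))
    have hx := exch (r := r) (i := i) (by omega) (ha i) (hb i) (hc i) (hv (by omega))
    have hV := fun a b x y z => V_Lm (r := r) st a b x y z i d (i+1) (by omega) (by omega)
    have hF := fun x y hx hy => flipB (r := r) st a b ha hb har hbr x y hx hy d i (by omega)
    have hF' := fun x y hx hy => flipB (r := r) st b c hb hc hbr hcr x y hx hy d i (by omega)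
    by_cases h1 : st i = 1
    · have h2 : ¬ st i = -1 := by omega
      simp only [Bm, Lm, un, vn, if_pos h1, if_neg h2] at *
      calc _ = Bm r st a b d (i+1) (b i) * (V r i v (b i) (a i) * U r i (a i) (b i) (a (i+1))) *
                Lm r st a b d (i+1) := by simp only [mul_assoc]
        _ = (Bm r st a b d (i+1) (b i) * U r i (b i) (c i) (a (i+1))) *
              (V r i v (c i) (b i) * Lm r st a b d (i+1)) := by rw [hx]; simp only [mul_assoc]
        _ = U r i (b i) (c i) (b (i+1)) * (Bm r st a b d (i+1) (c i) * Lm r st a b d (i+1)) *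
              V r i v (c i) (b i) := by rw [hF _ _ (hb i) (hc i), hV]; simp only [mul_assoc]
        _ = _ := by rw [h0]; simp only [mul_assoc]
    · by_cases h2 : st i = -1
      · simp only [Bm, Lm, un, vn, if_neg h1, if_pos h2] at *
        calc _ = V r i v (b i) (a i) * (Bm r st a b d (i+1) (a i) * Lm r st a b d (i+1)) *
                U r i (a i) (b i) (b (i+1)) := by simp only [mul_assoc]
          _ = (V r i v (b i) (a i) * Lm r st b c d (i+1)) * (Bm r st b c d (i+1) (a i) *
                U r i (a i) (b i) (b (i+1))) := by rw [h0]; simp only [mul_assoc]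
          _ = Lm r st b c d (i+1) * (V r i v (b i) (a i) * U r i (a i) (b i) (c (i+1))) *
                Bm r st b c d (i+1) (b i) := by
              rw [hF' _ _ (ha i) (hb i), hV]; simp only [mul_assoc]
          _ = _ := by rw [hx]; simp only [mul_assoc]
      · simp only [Bm, Lm, un, vn, if_neg h1, if_neg h2] at *
        calc _ = V r i v (b i) (a i) * (Bm r st a b d (i+1) (a i) * U r i (a i) (b i) (a (i+1))) *
                Lm r st a b d (i+1) := by simp only [mul_assoc]
          _ = (V r i v (b i) (a i) * U r i (a i) (b i) (b (i+1))) *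
                (Bm r st a b d (i+1) (b i) * Lm r st a b d (i+1)) := by
              rw [hF _ _ (ha i) (hb i)]; simp only [mul_assoc]
          _ = U r i (b i) (c i) (b (i+1)) * (V r i v (c i) (b i) * Lm r st b c d (i+1)) *
                Bm r st b c d (i+1) (b i) := by rw [hx, h0]; simp only [mul_assoc]
          _ = _ := by rw [hV]; simp only [mul_assoc]

lemma T_mul {r : ℕ} (p q : Fin (r+1)) (γ δ : ℝ) (A : Matrix (Fin (r+1)) (Fin (r+1)) ℝ) :
    T p q γ δ * A = A.updateRow p (γ • A p + δ • A q) := by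
  ext x y
  simp only [T, add_mul, one_mul, Matrix.add_apply]
  by_cases h : x = p
  · subst h
    simp
    ring
  · simp [h]

/-- all minors of the family belong to `S` -/
def TP {X : Type*} (S : Subsemiring (X → ℝ)) {r : ℕ}
    (A : X → Matrix (Fin (r+1)) (Fin (r+1)) ℝ) : Prop :=
  ∀ (k : ℕ) (I J : Fin k → Fin (r+1)), StrictMono I → StrictMono J →
    (fun x => ((A x).submatrix I J).det) ∈ S

lemma TP_one {X : Type*} (S : Subsemiring (X → ℝ)) {r : ℕ} :
    TP S (fun _ => (1 : Matrix (Fin (r+1)) (Fin (r+1)) ℝ)) := by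
  intro k I J hI hJ
  by_cases h : ∀ t, ∃ s, J s = I t
  · have : I = J := by
      have hr : Set.range I = Set.range J := by
        have h1 : Set.range I ⊆ Set.range J := by
          rintro _ ⟨t, rfl⟩
          exact h t
        apply Set.eq_of_subset_of_ncard_le h1 _ (Set.toFinite _)
        rw [← Set.image_univ, ← Set.image_univ, Set.ncard_image_of_injective _ hI.injective,
          Set.ncard_image_of_injective _ hJ.injective]
      exact (StrictMono.range_inj hI hJ).1 hr
    subst this
    have : (fun _ : X => ((1 : Matrix (Fin (r+1)) (Fin (r+1)) ℝ).submatrix I I).det) = 1 := by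
      funext x
      rw [Matrix.submatrix_one _ hI.injective]
      simp
    rw [this]
    exact S.one_mem
  · push Not at h
    obtain ⟨t, ht⟩ := h
    have : (fun _ : X => ((1 : Matrix (Fin (r+1)) (Fin (r+1)) ℝ).submatrix I J).det) = 0 := by
      funext x
      apply Matrix.det_eq_zero_of_row_eq_zero t
      intro j
      simp [Matrix.one_apply, (ht j).symm]
    rw [this]
    exact S.zero_mem

lemma TP_T {X : Type*} (S : Subsemiring (X → ℝ)) {r : ℕ}
    (A : X → Matrix (Fin (r+1)) (Fin (r+1)) ℝ) (hA : TP S A) (p q : Fin (r+1))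
    (hpq : (p : ℕ) + 1 = q ∨ (q : ℕ) + 1 = p) (γ δ : X → ℝ) (hγ : γ ∈ S) (hδ : δ ∈ S) :
    TP S (fun x => T p q (γ x) (δ x) * A x) := by
  intro k I J hI hJ
  simp only [T_mul]
  by_cases h : ∃ t, I t = p
  · obtain ⟨t, ht⟩ := h
    have key : ∀ x, (((A x).updateRow p (γ x • A x p + δ x • A x q)).submatrix I J).det =
        γ x * ((A x).submatrix I J).det +
          δ x * ((A x).submatrix (Function.update I t q) J).det := by
      intro x
      have e1 : ((A x).updateRow p (γ x • A x p + δ x • A x q)).submatrix I J =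
          ((A x).submatrix I J).updateRow t
            (γ x • (fun j => A x p (J j)) + δ x • (fun j => A x q (J j))) := by
        ext s j
        by_cases hs : s = t
        · subst hs
          simp [ht]
        · have : I s ≠ p := by rw [← ht]; exact fun h => hs (hI.injective h)
          simp [hs, this]
      rw [e1, Matrix.det_updateRow_add, Matrix.det_updateRow_smul, Matrix.det_updateRow_smul]
      congr 3
      · congr 1
        ext s j
        by_cases hs : s = t
        · subst hs
          simp [ht]
        · simp [hs]
      · congr 1
        ext s j
        by_cases hs : s = t
        · subst hs
          simp
        · simp [hs]
    have e2 : (fun x => (((A x).updateRow p (γ x • A x p + δ x • A x q)).submatrix I J).det) =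
        γ * (fun x => ((A x).submatrix I J).det) +
          δ * (fun x => ((A x).submatrix (Function.update I t q) J).det) := by
      funext x
      simp [key]
    rw [e2]
    refine S.add_mem (S.mul_mem hγ (hA k I J hI hJ)) (S.mul_mem hδ ?_)
    by_cases hq : ∃ s, I s = q
    · obtain ⟨s, hs⟩ := hq
      have hst : s ≠ t := by
        rintro rfl
        have : (p : ℕ) = q := by rw [← hs, ht]
        omega
      convert S.zero_mem using 1
      funext x
      apply Matrix.det_zero_of_row_eq hst
      ext j
      simp [hst, hs]
    · push Not at hq
      apply hA k _ J _ hJ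
      intro s s' hss
      have hs0 : ∀ u, (I u : ℕ) ≠ (q : ℕ) := fun u h => hq u (Fin.ext h)
      by_cases h1 : s = t
      · subst h1
        have h2 : s' ≠ s := hss.ne'
        have h3 : (p : ℕ) < I s' := by rw [← ht]; exact hI hss
        rw [Function.update_self, Function.update_of_ne h2, Fin.lt_def]
        have := hs0 s'
        omega
      · by_cases h2 : s' = t
        · subst h2
          have h3 : (I s : ℕ) < p := by rw [← ht]; exact hI hss
          rw [Function.update_self, Function.update_of_ne h1, Fin.lt_def]
          have := hs0 s
          omega
        · rw [Function.update_of_ne h1, Function.update_of_ne h2]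
          exact hI hss
  · push Not at h
    have : ∀ x, ((A x).updateRow p (γ x • A x p + δ x • A x q)).submatrix I J =
        (A x).submatrix I J := by
      intro x
      ext s j
      simp [h s]
    simp only [this]
    exact hA k I J hI hJ

/-- leading principal minors -/
noncomputable def lead {r : ℕ} (k : ℕ) (hk : k ≤ r + 1) (A : Matrix (Fin (r+1)) (Fin (r+1)) ℝ) : ℝ :=
  (A.submatrix (Fin.castLE hk) (Fin.castLE hk)).det

def Low {r : ℕ} (A : Matrix (Fin (r+1)) (Fin (r+1)) ℝ) : Prop := ∀ i j, i < j → A i j = 0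

lemma Low.mul {r : ℕ} {A B : Matrix (Fin (r+1)) (Fin (r+1)) ℝ} (hA : Low A) (hB : Low B) :
    Low (A * B) := by
  intro i j hij
  rw [Matrix.mul_apply]
  apply Finset.sum_eq_zero
  intro k _
  rcases lt_or_ge i k with h | h
  · rw [hA i k h, zero_mul]
  · rw [hB k j (lt_of_le_of_lt h hij), mul_zero]

lemma lead_mul {r : ℕ} (k : ℕ) (hk : k ≤ r + 1) {A : Matrix (Fin (r+1)) (Fin (r+1)) ℝ}
    (hA : Low A) (B : Matrix (Fin (r+1)) (Fin (r+1)) ℝ) :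
    lead k hk (A * B) = lead k hk A * lead k hk B := by
  unfold lead
  rw [← Matrix.det_mul]
  congr 1
  ext i j
  simp only [Matrix.submatrix_apply, Matrix.mul_apply]
  symm
  apply Finset.sum_of_injOn (Fin.castLE hk) (Fin.castLE_injective hk).injOn
  · simp
  · intro l _ hl
    rw [hA, zero_mul]
    rw [Fin.lt_def]
    by_contra h
    apply hl
    have : (l : ℕ) < k := by
      have := i.2
      simp only [Fin.val_castLE] at h
      omega
    exact ⟨⟨l, this⟩, by simp, by ext; simp⟩
  · intro l _
    rfl

lemma lead_transpose {r : ℕ} (k : ℕ) (hk : k ≤ r + 1) (A : Matrix (Fin (r+1)) (Fin (r+1)) ℝ) :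
    lead k hk Aᵀ = lead k hk A := by
  unfold lead
  rw [← Matrix.det_transpose]
  rfl

lemma lead_mul' {r : ℕ} (k : ℕ) (hk : k ≤ r + 1) (A : Matrix (Fin (r+1)) (Fin (r+1)) ℝ)
    {B : Matrix (Fin (r+1)) (Fin (r+1)) ℝ} (hB : Low Bᵀ) :
    lead k hk (A * B) = lead k hk A * lead k hk B := by
  rw [← lead_transpose, Matrix.transpose_mul, lead_mul k hk hB, lead_transpose, lead_transpose,
    mul_comm]

lemma lead_one {r : ℕ} (k : ℕ) (hk : k ≤ r + 1) :
    lead k hk (1 : Matrix (Fin (r+1)) (Fin (r+1)) ℝ) = 1 := by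
  unfold lead
  rw [Matrix.submatrix_one _ (Fin.castLE_injective hk), Matrix.det_one]

lemma Low_one {r : ℕ} : Low (1 : Matrix (Fin (r+1)) (Fin (r+1)) ℝ) := by
  intro i j hij
  exact Matrix.one_apply_ne hij.ne

lemma Low_T {r : ℕ} {p q : Fin (r+1)} (h : q < p) (γ δ : ℝ) : Low (T p q γ δ) := by
  intro i j hij
  have h1 : ¬ (p = i ∧ p = j) := by rintro ⟨rfl, rfl⟩; exact lt_irrefl _ hij
  have h2 : ¬ (p = i ∧ q = j) := by rintro ⟨rfl, rfl⟩; exact lt_asymm h hij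
  simp [T, Matrix.single_apply, h1, h2, hij.ne]

lemma Up_T {r : ℕ} {p q : Fin (r+1)} (h : p < q) (γ δ : ℝ) : Low (T p q γ δ)ᵀ := by
  intro i j hij
  have h1 : ¬ (p = j ∧ p = i) := by rintro ⟨rfl, rfl⟩; exact lt_irrefl _ hij
  have h2 : ¬ (p = j ∧ q = i) := by rintro ⟨rfl, rfl⟩; exact lt_asymm h hij
  simp [T, Matrix.single_apply, h1, h2, hij.ne']

lemma lead_of_low {r : ℕ} (k : ℕ) (hk : k ≤ r + 1) {A : Matrix (Fin (r+1)) (Fin (r+1)) ℝ}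
    (hA : Low A) : lead k hk A = ∏ i : Fin k, A (Fin.castLE hk i) (Fin.castLE hk i) := by
  unfold lead
  rw [Matrix.det_of_isLowerTriangular]
  · rfl
  · intro i j hij
    exact hA _ _ hij

lemma T_diag {r : ℕ} {p q : Fin (r+1)} (h : p ≠ q) (γ δ : ℝ) (i : Fin (r+1)) :
    T p q γ δ i i = if i = p then γ else 1 := by
  have h2 : ¬ (p = i ∧ q = i) := by rintro ⟨rfl, rfl⟩; exact h rfl
  by_cases h3 : i = p
  · subst h3; simp [T, Matrix.single_apply, h.symm]
  · simp [T, Matrix.single_apply, h2, h3, Ne.symm h3]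

lemma prod_aux {r : ℕ} (k : ℕ) (hk : k ≤ r + 1) (p : Fin (r+1)) (γ : ℝ) :
    (∏ i : Fin k, if Fin.castLE hk i = p then γ else 1) = if (p : ℕ) < k then γ else 1 := by
  split_ifs with h
  · rw [Finset.prod_eq_single (⟨p, h⟩ : Fin k)]
    · rw [if_pos]; ext; simp
    · intro b _ hb
      rw [if_neg]
      rintro rfl
      exact hb (by ext; simp)
    · simp
  · apply Finset.prod_eq_one
    intro i _
    rw [if_neg]
    rintro rfl
    exact h i.2

lemma lead_T_low {r : ℕ} (k : ℕ) (hk : k ≤ r + 1) {p q : Fin (r+1)} (h : q < p) (γ δ : ℝ) :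
    lead k hk (T p q γ δ) = if (p : ℕ) < k then γ else 1 := by
  rw [lead_of_low k hk (Low_T h γ δ), ← prod_aux k hk]
  simp only [T_diag h.ne']

lemma lead_T_up {r : ℕ} (k : ℕ) (hk : k ≤ r + 1) {p q : Fin (r+1)} (h : p < q) (γ δ : ℝ) :
    lead k hk (T p q γ δ) = if (p : ℕ) < k then γ else 1 := by
  rw [← lead_transpose, lead_of_low k hk (Up_T h γ δ), ← prod_aux k hk]
  simp only [Matrix.transpose_apply, T_diag h.ne]

lemma e_val {r i : ℕ} (hi : i ≤ r) : ((Fin.ofNat (r+1) i : Fin (r+1)) : ℕ) = i := by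
  simp only [Fin.ofNat, Nat.mod_eq_of_lt (Nat.lt_succ_of_le hi)]

lemma e_lt {r i : ℕ} (hi : i < r) : Fin.ofNat (r+1) i < Fin.ofNat (r+1) (i+1) := by
  rw [Fin.lt_def, e_val (by omega), e_val (by omega)]
  omega

lemma Low_Lm {r : ℕ} (st : ℕ → ℤ) (a b : ℕ → ℝ) : ∀ d i, i + d = r → Low (Lm r st a b d i) := by
  intro d
  induction d with
  | zero => intro i _; exact Low_one
  | succ d ih =>
    intro i hd
    have h1 := ih (i+1) (by omega)
    have h2 := fun x y => Low_T (e_lt (r := r) (i := i) (by omega)) x y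
    simp only [Lm]
    split_ifs
    · exact h1.mul (h2 _ _)
    · exact (h2 _ _).mul h1

lemma Up_Bm {r : ℕ} (st : ℕ → ℤ) (a b : ℕ → ℝ) :
    ∀ d i v, i + d = r → Low (Bm r st a b d i v)ᵀ := by
  intro d
  induction d with
  | zero => intro i _ _; simp only [Bm, Matrix.transpose_one]; exact Low_one
  | succ d ih =>
    intro i v hd
    have h1 := fun v => ih (i+1) v (by omega)
    have h2 := fun x y => Up_T (e_lt (r := r) (i := i) (by omega)) x y
    simp only [Bm]
    split_ifs
    · rw [Matrix.transpose_mul]; exact (h2 _ _).mul (h1 _)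
    · rw [Matrix.transpose_mul]; exact (h1 _).mul (h2 _ _)

lemma lead_Lm {r : ℕ} (st : ℕ → ℤ) (a b : ℕ → ℝ) (k : ℕ) (hk : k ≤ r + 1) :
    ∀ d i, i + d = r → lead k hk (Lm r st a b d i) =
      ∏ j ∈ Finset.range d, if i + j + 1 < k then a (i + j) / b (i + j) else 1 := by
  intro d
  induction d with
  | zero => intro i _; simp [Lm, lead_one]
  | succ d ih =>
    intro i hd
    have h1 := ih (i+1) (by omega)
    have hU : ∀ u, lead k hk (U r i (a i) (b i) u) = if i + 1 < k then a i / b i else 1 := by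
      intro u
      unfold U
      rw [lead_T_low k hk (e_lt (by omega)), e_val (by omega)]
    have hL := Low_Lm st a b d (i+1) (by omega : _ = r)
    have hUL : ∀ u, Low (U r i (a i) (b i) u) := fun u => Low_T (e_lt (by omega)) _ _
    rw [Finset.prod_range_succ']
    have e : (∏ j ∈ Finset.range d, if i + (j + 1) + 1 < k then a (i + (j + 1)) / b (i + (j + 1)) else 1)
        = lead k hk (Lm r st a b d (i+1)) := by
      rw [h1]
      refine Finset.prod_congr rfl fun j _ => ?_
      rw [show i + (j + 1) = i + 1 + j by omega]
    rw [e]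
    simp only [Lm, add_zero]
    split_ifs with h2 h3 h3
    · rw [lead_mul k hk hL, hU, if_pos h3]
    · rw [lead_mul k hk hL, hU, if_neg h3]
    · rw [lead_mul k hk (hUL _), hU, if_pos h3, mul_comm]
    · rw [lead_mul k hk (hUL _), hU, if_neg h3, mul_comm]

lemma lead_Bm {r : ℕ} (st : ℕ → ℤ) (a b : ℕ → ℝ) (k : ℕ) (hk : k ≤ r + 1) :
    ∀ d i v, i + d = r → lead k hk (Bm r st a b d i v) =
      ∏ j ∈ Finset.range d, if i + j < k then b (i + j) / a (i + j) else 1 := by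
  intro d
  induction d with
  | zero => intro i _ _; simp [Bm, lead_one]
  | succ d ih =>
    intro i v hd
    have h1 := fun v => ih (i+1) v (by omega)
    have hU : ∀ u, lead k hk (V r i u (b i) (a i)) = if i < k then b i / a i else 1 := by
      intro u
      unfold V
      rw [lead_T_up k hk (e_lt (by omega)), e_val (by omega)]
    have hL := fun v => Up_Bm st a b d (i+1) v (by omega : _ = r)
    have hUL : ∀ u, Low (V r i u (b i) (a i))ᵀ := fun u => Up_T (e_lt (by omega)) _ _
    rw [Finset.prod_range_succ']
    have e : (∏ j ∈ Finset.range d, if i + (j + 1) < k then b (i + (j + 1)) / a (i + (j + 1)) else 1)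
        = lead k hk (Bm r st a b d (i+1) 0) := by
      rw [h1]
      refine Finset.prod_congr rfl fun j _ => ?_
      rw [show i + (j + 1) = i + 1 + j by omega]
    rw [e]
    have h1 : ∀ w, lead k hk (Bm r st a b d (i+1) w) = lead k hk (Bm r st a b d (i+1) 0) :=
      fun w => by rw [h1, h1]
    simp only [Bm, add_zero]
    split_ifs with h2 h3 h3
    · rw [lead_mul' k hk _ (hUL _), hU, if_pos h3, h1]
    · rw [lead_mul' k hk _ (hUL _), hU, if_neg h3, h1]
    · rw [lead_mul' k hk _ (hL _), hU, if_pos h3, h1, mul_comm]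
    · rw [lead_mul' k hk _ (hL _), hU, if_neg h3, h1, mul_comm]

lemma lead_LB {r : ℕ} (st : ℕ → ℤ) (a b : ℕ → ℝ) (ha : ∀ i, 0 < a i) (hb : ∀ i, 0 < b i)
    (k : ℕ) (hk : k + 1 ≤ r + 1) (hkr : k < r) (v : ℝ) :
    lead (k+1) hk (Lm r st a b r 0) * lead (k+1) hk (Bm r st a b r 0 v) = b k / a k := by
  rw [lead_Lm st a b (k+1) hk r 0 (by omega), lead_Bm st a b (k+1) hk r 0 v (by omega),
    ← Finset.prod_mul_distrib, Finset.prod_eq_single k]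
  · simp
  · intro j _ hj
    have h1 := (ha j).ne'
    have h2 := (hb j).ne'
    simp only [zero_add]
    by_cases h : j < k
    · rw [if_pos (by omega), if_pos (by omega)]
      field_simp
    · rw [if_neg (by omega), if_neg (by omega), mul_one]
  · intro h
    exact absurd (Finset.mem_range.2 hkr) h

def Pres {X : Type*} (S : Subsemiring (X → ℝ)) {r : ℕ}
    (A : X → Matrix (Fin (r+1)) (Fin (r+1)) ℝ) : Prop :=
  ∀ B : X → Matrix (Fin (r+1)) (Fin (r+1)) ℝ, TP S B → TP S (fun x => A x * B x)

lemma Pres.mul {X : Type*} {S : Subsemiring (X → ℝ)} {r : ℕ}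
    {A B : X → Matrix (Fin (r+1)) (Fin (r+1)) ℝ} (hA : Pres S A) (hB : Pres S B) :
    Pres S (fun x => A x * B x) := by
  intro C hC
  have := hA _ (hB C hC)
  simpa only [mul_assoc] using this

lemma Pres_one {X : Type*} {S : Subsemiring (X → ℝ)} {r : ℕ} :
    Pres S (fun _ => (1 : Matrix (Fin (r+1)) (Fin (r+1)) ℝ)) := by
  intro C hC
  simpa using hC

lemma Pres_V {X : Type*} {S : Subsemiring (X → ℝ)} {r i : ℕ} (hi : i < r) {v b a : X → ℝ}
    (hv : v ∈ S) (hb : b ∈ S) (ha : a⁻¹ ∈ S) :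
    Pres S (fun x => V r i (v x) (b x) (a x)) := by
  intro C hC
  refine TP_T S C hC _ _ ?_ (fun x => b x / a x) (fun x => v x / a x) ?_ ?_
  · rw [e_val (by omega), e_val (by omega)]; omega
  · exact S.mul_mem hb ha
  · exact S.mul_mem hv ha

lemma Pres_U {X : Type*} {S : Subsemiring (X → ℝ)} {r i : ℕ} (hi : i < r) {a b u : X → ℝ}
    (ha : a ∈ S) (hb : b⁻¹ ∈ S) (hu : u ∈ S) :
    Pres S (fun x => U r i (a x) (b x) (u x)) := by
  intro C hC
  refine TP_T S C hC _ _ ?_ (fun x => a x / b x) (fun x => u x / b x) ?_ ?_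
  · rw [e_val (by omega), e_val (by omega)]; omega
  · exact S.mul_mem ha hb
  · exact S.mul_mem hu hb

lemma Pres_Lm {X : Type*} {S : Subsemiring (X → ℝ)} {r : ℕ} (st : ℕ → ℤ) (a b : ℕ → X → ℝ)
    (ha : ∀ i, i ≤ r → a i ∈ S) (hb : ∀ i, i ≤ r → b i ∈ S) (hb' : ∀ i, i ≤ r → (b i)⁻¹ ∈ S) :
    ∀ d i, i + d = r → Pres S (fun x => Lm r st (fun i => a i x) (fun i => b i x) d i) := by
  intro d
  induction d with
  | zero => intro i _; exact Pres_one
  | succ d ih =>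
    intro i hd
    have h1 := ih (i+1) (by omega)
    simp only [Lm]
    split_ifs
    · exact h1.mul (Pres_U (by omega) (ha _ (by omega)) (hb' _ (by omega)) (hb _ (by omega)))
    · exact (Pres_U (by omega) (ha _ (by omega)) (hb' _ (by omega)) (ha _ (by omega))).mul h1

lemma Pres_Bm {X : Type*} {S : Subsemiring (X → ℝ)} {r : ℕ} (st : ℕ → ℤ) (a b : ℕ → X → ℝ)
    (ha : ∀ i, i ≤ r → a i ∈ S) (hb : ∀ i, i ≤ r → b i ∈ S) (ha' : ∀ i, i ≤ r → (a i)⁻¹ ∈ S) :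
    ∀ d i, ∀ v ∈ S, i + d = r →
      Pres S (fun x => Bm r st (fun i => a i x) (fun i => b i x) d i (v x)) := by
  intro d
  induction d with
  | zero => intro i _ _ _; exact Pres_one
  | succ d ih =>
    intro i v hv hd
    have h1 := fun v hv => ih (i+1) v hv (by omega)
    simp only [Bm]
    split_ifs
    · exact (h1 _ (hb i (by omega))).mul (Pres_V (by omega) hv (hb _ (by omega)) (ha' _ (by omega)))
    · exact (Pres_V (by omega) hv (hb _ (by omega)) (ha' _ (by omega))).mul (h1 _ (ha i (by omega)))

/-- solutions of the Q-system -/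
structure Sol (r : ℕ) (R : ℕ → ℤ → ℝ) : Prop where
  pos : ∀ β, β ≤ r + 1 → ∀ k : ℤ, 0 < R β k
  zero : ∀ k : ℤ, R 0 k = 1
  top : ∀ k : ℤ, R (r + 1) k = 1
  rel : ∀ β, 1 ≤ β → β ≤ r → ∀ k : ℤ,
          R β (k + 1) * R β (k - 1) = R β k ^ 2 + R (β + 1) k * R (β - 1) k

/-- row values, padded by one -/
noncomputable def row (r : ℕ) (m : ℕ → ℤ) (R : ℕ → ℤ → ℝ) (t : ℤ) (i : ℕ) : ℝ :=
  if i ≤ r then R (i+1) (m (i+1) + t) else 1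

lemma row_pos {r : ℕ} {m : ℕ → ℤ} {R : ℕ → ℤ → ℝ} (h : Sol r R) (t : ℤ) (i : ℕ) :
    0 < row r m R t i := by
  unfold row
  split_ifs
  · exact h.pos _ (by omega) _
  · exact one_pos

lemma row_top {r : ℕ} {m : ℕ → ℤ} {R : ℕ → ℤ → ℝ} (h : Sol r R) (t : ℤ) :
    row r m R t r = 1 := by
  unfold row
  rw [if_pos le_rfl, h.top]

def stp (m : ℕ → ℤ) (i : ℕ) : ℤ := m (i+2) - m (i+1)

lemma un_row {r : ℕ} {m : ℕ → ℤ} {R : ℕ → ℤ → ℝ} 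
    (hm : ∀ i, 1 ≤ i → i ≤ r → |m (i+1) - m i| ≤ 1) (t : ℤ) (i : ℕ) (hi : i < r) :
    un (stp m) (row r m R t) (row r m R (t+1)) (row r m R (t+2)) i =
      R (i+2) (m (i+1) + t + 1) := by
  have h := abs_le.1 (hm (i+1) (by omega) (by omega))
  unfold un stp row
  rw [if_pos (by omega : i + 1 ≤ r), if_pos (by omega : i + 1 ≤ r), if_pos (by omega : i + 1 ≤ r)]
  have e : i + 1 + 1 = i + 2 := rfl
  rw [e] at *
  split_ifs with h1 h2 <;> congr 1 <;> omega

lemma vn_row {r : ℕ} {m : ℕ → ℤ} {R : ℕ → ℤ → ℝ} 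
    (hm : ∀ i, 1 ≤ i → i ≤ r → |m (i+1) - m i| ≤ 1) (t : ℤ) (i : ℕ) (hi : i < r) :
    vn (stp m) (row r m R t) (row r m R (t+1)) (row r m R (t+2)) i =
      R (i+1) (m (i+2) + t + 1) := by
  have h := abs_le.1 (hm (i+1) (by omega) (by omega))
  unfold vn stp row
  rw [if_pos (by omega : i ≤ r), if_pos (by omega : i ≤ r), if_pos (by omega : i ≤ r)]
  have e : i + 1 + 1 = i + 2 := rfl
  rw [e] at *
  split_ifs with h1 h2 <;> congr 1 <;> omega

lemma row_rel {r : ℕ} {m : ℕ → ℤ} {R : ℕ → ℤ → ℝ} (h : Sol r R) (t : ℤ) (i : ℕ) (hi : i < r) :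
    row r m R t i * row r m R (t+2) i = row r m R (t+1) i ^ 2 +
      R (i+2) (m (i+1) + t + 1) * R i (m (i+1) + t + 1) := by
  have := h.rel (i+1) (by omega) (by omega) (m (i+1) + t + 1)
  unfold row
  rw [if_pos (by omega : i ≤ r), if_pos (by omega : i ≤ r), if_pos (by omega : i ≤ r)]
  have e1 : m (i+1) + t + 1 + 1 = m (i+1) + (t + 2) := by ring
  have e2 : m (i+1) + t + 1 - 1 = m (i+1) + t := by ring
  rw [e1, e2, Nat.add_sub_cancel] at this
  rw [mul_comm, this, add_assoc (m (i+1)) t 1]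

noncomputable def LL (r : ℕ) (m : ℕ → ℤ) (R : ℕ → ℤ → ℝ) (t : ℤ) :=
  Lm r (stp m) (row r m R t) (row r m R (t+1)) r 0
noncomputable def BB (r : ℕ) (m : ℕ → ℤ) (R : ℕ → ℤ → ℝ) (t : ℤ) :=
  Bm r (stp m) (row r m R t) (row r m R (t+1)) r 0 1

lemma BB_LL {r : ℕ} {m : ℕ → ℤ} {R : ℕ → ℤ → ℝ} (h : Sol r R)
    (hm : ∀ i, 1 ≤ i → i ≤ r → |m (i+1) - m i| ≤ 1) (t : ℤ) :
    BB r m R t * LL r m R t = LL r m R (t+1) * BB r m R (t+1) := by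
  unfold BB LL
  have e : t + 1 + 1 = t + 2 := by ring
  rw [e]
  apply BL _ _ _ _ (row_pos h t) (row_pos h _) (row_pos h _) (row_top h _) (row_top h _) (row_top h _)
  · intro i hi
    rw [un_row hm t (i+1) hi, vn_row hm t i (by omega), row_rel h t (i+1) hi]
  · omega
  · intro hr
    rw [un_row hm t 0 hr, row_rel h t 0 hr, h.zero]

lemma pow_swap {M : Type*} [Monoid M] (L B : M) (k : ℕ) : (L * B) ^ (k+1) = L * (B * L) ^ k * B := by
  induction k with
  | zero => simp
  | succ k ih => rw [pow_succ', ih, pow_succ' (B * L)]; simp only [mul_assoc]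

lemma lead_pow {r : ℕ} {m : ℕ → ℤ} {R : ℕ → ℤ → ℝ} (h : Sol r R)
    (hm : ∀ i, 1 ≤ i → i ≤ r → |m (i+1) - m i| ≤ 1) (j : ℕ) (hj : j + 1 ≤ r + 1) (hjr : j < r) :
    ∀ (k : ℕ) (t : ℤ), row r m R t j * lead (j+1) hj ((LL r m R t * BB r m R t) ^ k) =
      row r m R (t + k) j := by
  intro k
  induction k with
  | zero => intro t; simp [lead_one]
  | succ k ih =>
    intro t
    rw [pow_swap, BB_LL h hm, lead_mul' _ _ _ (B := BB r m R t) (Up_Bm _ _ _ _ _ _ (by omega)),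
      lead_mul _ _ (A := LL r m R t) (Low_Lm _ _ _ _ _ (by omega))]
    have h1 := lead_LB (stp m) (row r m R t) (row r m R (t+1)) (row_pos h _) (row_pos h _) j hj hjr 1
    have h2 := ih (t+1)
    have e : t + ((k + 1 : ℕ) : ℤ) = t + 1 + k := by push_cast; ring
    rw [e, ← h2]
    have h3 := (row_pos (m := m) h t j).ne'
    change lead (j+1) hj (LL r m R t) * lead (j+1) hj (BB r m R t) = _ at h1
    rw [eq_div_iff h3] at h1
    rw [← h1]
    ring

theorem core {X : Type*} (S : Subsemiring (X → ℝ)) {r : ℕ} (m : ℕ → ℤ)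
    (hm : ∀ i, 1 ≤ i → i ≤ r → |m (i+1) - m i| ≤ 1) (R : X → ℕ → ℤ → ℝ) (hR : ∀ x, Sol r (R x))
    (h0 : ∀ i, 1 ≤ i → i ≤ r → (fun x => R x i (m i)) ∈ S)
    (h1 : ∀ i, 1 ≤ i → i ≤ r → (fun x => R x i (m i + 1)) ∈ S)
    (h0' : ∀ i, 1 ≤ i → i ≤ r → (fun x => R x i (m i))⁻¹ ∈ S)
    (h1' : ∀ i, 1 ≤ i → i ≤ r → (fun x => R x i (m i + 1))⁻¹ ∈ S)
    (α : ℕ) (hα1 : 1 ≤ α) (hα2 : α ≤ r) (n : ℤ) (hn : m α ≤ n) :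
    (fun x => R x α n) ∈ S := by
  have a0 : ∀ i, i ≤ r → (fun x => row r m (R x) 0 i) ∈ S := by
    intro i hi
    rcases hi.lt_or_eq with h | rfl
    · simpa only [row, if_pos hi, add_zero] using h0 (i+1) (by omega) (by omega)
    · simp only [row_top (hR _)]; exact S.one_mem
  have a1 : ∀ i, i ≤ r → (fun x => row r m (R x) (0+1) i) ∈ S := by
    intro i hi
    rcases hi.lt_or_eq with h | rfl
    · simpa only [row, if_pos hi, zero_add] using h1 (i+1) (by omega) (by omega)
    · simp only [row_top (hR _)]; exact S.one_mem
  have a0' : ∀ i, i ≤ r → (fun x => row r m (R x) 0 i)⁻¹ ∈ S := by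
    intro i hi
    rcases hi.lt_or_eq with h | rfl
    · simpa only [row, if_pos hi, add_zero] using h0' (i+1) (by omega) (by omega)
    · simp only [row_top (hR _)]
      convert S.one_mem using 1
      funext x; simp
  have a1' : ∀ i, i ≤ r → (fun x => row r m (R x) (0+1) i)⁻¹ ∈ S := by
    intro i hi
    rcases hi.lt_or_eq with h | rfl
    · simpa only [row, if_pos hi, zero_add] using h1' (i+1) (by omega) (by omega)
    · simp only [row_top (hR _)]
      convert S.one_mem using 1
      funext x; simp
  have pL : Pres S (fun x => LL r m (R x) 0) :=
    Pres_Lm (stp m) (fun i x => row r m (R x) 0 i) (fun i x => row r m (R x) (0+1) i) a0 a1 a1' r 0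
      (by omega)
  have pB : Pres S (fun x => BB r m (R x) 0) :=
    Pres_Bm (stp m) (fun i x => row r m (R x) 0 i) (fun i x => row r m (R x) (0+1) i) a0 a1 a0' r 0
      1 S.one_mem (by omega)
  have pP : ∀ k : ℕ, TP S (fun x => (LL r m (R x) 0 * BB r m (R x) 0) ^ k) := by
    intro k
    induction k with
    | zero => simpa only [pow_zero] using TP_one S
    | succ k ih =>
      simp only [pow_succ']
      exact (pL.mul pB) _ ih
  obtain ⟨j, rfl⟩ : ∃ j, α = j + 1 := ⟨α - 1, by omega⟩
  obtain ⟨k, hk⟩ := Int.eq_ofNat_of_zero_le (sub_nonneg.2 hn)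
  have hj : j + 1 ≤ r + 1 := by omega
  have key : (fun x => R x (j+1) n) = (fun x => row r m (R x) 0 j) *
      (fun x => lead (j+1) hj ((LL r m (R x) 0 * BB r m (R x) 0) ^ k)) := by
    funext x
    have := lead_pow (hR x) hm j hj (by omega) k 0
    rw [Pi.mul_apply, this, row, if_pos (by omega)]
    congr 1
    omega
  rw [key]
  exact S.mul_mem (a0 j (by omega)) (pP k (j+1) _ _ (Fin.strictMono_castLE hj) (Fin.strictMono_castLE hj))

/-- positive Laurent polynomials in the functions `y s` -/
noncomputable def LP {X σ : Type*} (y : X → σ → ℝ) (hy : ∀ x s, 0 < y x s) : Subsemiring (X → ℝ) where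
  carrier := {f | ∃ (P : MvPolynomial σ ℤ) (d : σ →₀ ℕ), (∀ v, 0 ≤ P.coeff v) ∧
    ∀ x, f x = MvPolynomial.eval₂ (Int.castRingHom ℝ) (y x) P /
      MvPolynomial.eval₂ (Int.castRingHom ℝ) (y x) (MvPolynomial.monomial d 1)}
  zero_mem' := ⟨0, 0, by simp, by simp⟩
  one_mem' := by
    classical
    refine ⟨1, 0, fun v => ?_, fun x => by simp⟩
    rw [MvPolynomial.coeff_one]
    split_ifs <;> norm_num
  mul_mem' := by
    classical
    rintro f g ⟨P, d, hP, hf⟩ ⟨Q, e, hQ, hg⟩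
    refine ⟨P * Q, d + e, fun v => ?_, fun x => ?_⟩
    · rw [MvPolynomial.coeff_mul]
      exact Finset.sum_nonneg fun p _ => mul_nonneg (hP _) (hQ _)
    · have : (MvPolynomial.monomial (d + e) (1:ℤ)) =
        MvPolynomial.monomial d 1 * MvPolynomial.monomial e 1 := by
        rw [MvPolynomial.monomial_mul, one_mul]
      rw [Pi.mul_apply, hf, hg, this, MvPolynomial.eval₂_mul, MvPolynomial.eval₂_mul,
        div_mul_div_comm]
  add_mem' := by
    classical
    rintro f g ⟨P, d, hP, hf⟩ ⟨Q, e, hQ, hg⟩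
    have hmon : ∀ (d : σ →₀ ℕ) (v), 0 ≤ (MvPolynomial.monomial d (1:ℤ)).coeff v := by
      intro d v
      rw [MvPolynomial.coeff_monomial]
      split_ifs <;> norm_num
    refine ⟨P * MvPolynomial.monomial e 1 + Q * MvPolynomial.monomial d 1, d + e, fun v => ?_,
      fun x => ?_⟩
    · rw [MvPolynomial.coeff_add, MvPolynomial.coeff_mul, MvPolynomial.coeff_mul]
      exact add_nonneg (Finset.sum_nonneg fun p _ => mul_nonneg (hP _) (hmon _ _))
        (Finset.sum_nonneg fun p _ => mul_nonneg (hQ _) (hmon _ _))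
    · have : (MvPolynomial.monomial (d + e) (1:ℤ)) =
        MvPolynomial.monomial d 1 * MvPolynomial.monomial e 1 := by
        rw [MvPolynomial.monomial_mul, one_mul]
      have hne : ∀ d : σ →₀ ℕ, MvPolynomial.eval₂ (Int.castRingHom ℝ) (y x)
          (MvPolynomial.monomial d 1) ≠ 0 := by
        intro d
        rw [MvPolynomial.eval₂_monomial, map_one, one_mul]
        exact Finset.prod_ne_zero_iff.2 fun s _ => pow_ne_zero _ (hy x s).ne'
      rw [Pi.add_apply, hf, hg, this, MvPolynomial.eval₂_mul, MvPolynomial.eval₂_add,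
        MvPolynomial.eval₂_mul, MvPolynomial.eval₂_mul, div_add_div _ _ (hne d) (hne e)]
      ring

lemma LP_var {X σ : Type*} (y : X → σ → ℝ) (hy : ∀ x s, 0 < y x s) (s : σ) :
    (fun x => y x s) ∈ LP y hy := by
  classical
  refine ⟨MvPolynomial.X s, 0, fun v => ?_, fun x => by simp⟩
  rw [MvPolynomial.coeff_X]
  split_ifs <;> norm_num

lemma LP_inv {X σ : Type*} (y : X → σ → ℝ) (hy : ∀ x s, 0 < y x s) (s : σ) :
    (fun x => y x s)⁻¹ ∈ LP y hy := by
  classical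
  refine ⟨1, Finsupp.single s 1, fun v => ?_, fun x => ?_⟩
  · rw [MvPolynomial.coeff_one]
    split_ifs <;> norm_num
  · rw [MvPolynomial.eval₂_monomial]
    simp

lemma Sol.reflect {r : ℕ} {R : ℕ → ℤ → ℝ} (h : Sol r R) : Sol r (fun β k => R β (-k)) where
  pos β hβ k := h.pos β hβ _
  zero k := h.zero _
  top k := h.top _
  rel β h1 h2 k := by
    have := h.rel β h1 h2 (-k)
    have e1 : -(k + 1) = -k - 1 := by ring
    have e2 : -(k - 1) = -k + 1 := by ring
    rw [e1, e2, mul_comm, this]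

end QSys

/-- positive Laurent property of the A_r Q-system with respect
to the seed of any Motzkin path m = (m_1,…,m_r).  The 2r seed variables are
indexed by Fin r ⊕ Fin r: Sum.inl β ↦ R_{β+1, m_{β+1}} and
Sum.inr β ↦ R_{β+1, m_{β+1}+1}.  There exist a polynomial P with nonnegative
integer coefficients and a monomial (exponent vector d) in these 2r
variables, depending only on r, m, α, n, such that every A_r Q-system
solution satisfies R_{α,n} = P(seed)/M(seed). -/
theorem qsystem_positive_laurent (r : ℕ) (hr : 1 ≤ r) (m : ℕ → ℤ)
    (hm : ∀ α : ℕ, 1 ≤ α → α + 1 ≤ r → |m (α + 1) - m α| ≤ 1)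
    (α : ℕ) (hα1 : 1 ≤ α) (hα2 : α ≤ r) (n : ℤ) :
    ∃ (P : MvPolynomial (Fin r ⊕ Fin r) ℤ) (d : (Fin r ⊕ Fin r) →₀ ℕ),
      (∀ v : (Fin r ⊕ Fin r) →₀ ℕ, 0 ≤ P.coeff v) ∧
      ∀ R : ℕ → ℤ → ℝ,
        (∀ β, β ≤ r + 1 → ∀ k : ℤ, 0 < R β k) →
        (∀ k : ℤ, R 0 k = 1) → (∀ k : ℤ, R (r + 1) k = 1) →
        (∀ β, 1 ≤ β → β ≤ r → ∀ k : ℤ,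
          R β (k + 1) * R β (k - 1) = R β k ^ 2 + R (β + 1) k * R (β - 1) k) →
        R α n =
          MvPolynomial.eval₂ (Int.castRingHom ℝ)
            (Sum.elim (fun β : Fin r => R ((β : ℕ) + 1) (m ((β : ℕ) + 1)))
              (fun β : Fin r => R ((β : ℕ) + 1) (m ((β : ℕ) + 1) + 1))) P /
          MvPolynomial.eval₂ (Int.castRingHom ℝ)
            (Sum.elim (fun β : Fin r => R ((β : ℕ) + 1) (m ((β : ℕ) + 1)))
              (fun β : Fin r => R ((β : ℕ) + 1) (m ((β : ℕ) + 1) + 1)))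
            (MvPolynomial.monomial d 1) := by
  classical
  let X := {R : ℕ → ℤ → ℝ // QSys.Sol r R}
  let y : X → (Fin r ⊕ Fin r) → ℝ := fun R =>
    Sum.elim (fun β : Fin r => R.1 ((β : ℕ) + 1) (m ((β : ℕ) + 1)))
              (fun β : Fin r => R.1 ((β : ℕ) + 1) (m ((β : ℕ) + 1) + 1))
  have hy : ∀ x s, 0 < y x s := by
    rintro x (s | s)
    · exact x.2.pos _ (by omega) _
    · exact x.2.pos _ (by omega) _
  let m' : ℕ → ℤ := fun i => if i ≤ r then m i else m r
  have hm'e : ∀ i, i ≤ r → m' i = m i := fun i hi => if_pos hi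
  have hm' : ∀ i, 1 ≤ i → i ≤ r → |m' (i+1) - m' i| ≤ 1 := by
    intro i h1 h2
    rcases h2.lt_or_eq with h | rfl
    · rw [hm'e _ h2, hm'e _ h]; exact hm i h1 h
    · simp [m']
  have v0 : ∀ i, 1 ≤ i → i ≤ r → (fun x : X => x.1 i (m' i)) ∈ QSys.LP y hy ∧
      (fun x : X => x.1 i (m' i))⁻¹ ∈ QSys.LP y hy := by
    intro i h1 h2
    obtain ⟨j, rfl⟩ : ∃ j, i = j + 1 := ⟨i - 1, by omega⟩
    rw [hm'e _ h2]
    exact ⟨QSys.LP_var y hy (Sum.inl ⟨j, h2⟩), QSys.LP_inv y hy (Sum.inl ⟨j, h2⟩)⟩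
  have v1 : ∀ i, 1 ≤ i → i ≤ r → (fun x : X => x.1 i (m' i + 1)) ∈ QSys.LP y hy ∧
      (fun x : X => x.1 i (m' i + 1))⁻¹ ∈ QSys.LP y hy := by
    intro i h1 h2
    obtain ⟨j, rfl⟩ : ∃ j, i = j + 1 := ⟨i - 1, by omega⟩
    rw [hm'e _ h2]
    exact ⟨QSys.LP_var y hy (Sum.inr ⟨j, h2⟩), QSys.LP_inv y hy (Sum.inr ⟨j, h2⟩)⟩
  have main : (fun x : X => x.1 α n) ∈ QSys.LP y hy := by
    rcases le_or_gt (m' α) n with hn | hn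
    · exact QSys.core (QSys.LP y hy) m' hm' (fun x => x.1) (fun x => x.2)
        (fun i h1 h2 => (v0 i h1 h2).1) (fun i h1 h2 => (v1 i h1 h2).1)
        (fun i h1 h2 => (v0 i h1 h2).2) (fun i h1 h2 => (v1 i h1 h2).2) α hα1 hα2 n hn
    · have e1 : ∀ i, - (-m' i - 1) = m' i + 1 := fun i => by ring
      have e2 : ∀ i, - (-m' i - 1 + 1) = m' i := fun i => by ring
      have := QSys.core (QSys.LP y hy) (fun i => - m' i - 1)
        (fun i h1 h2 => by
          have := hm' i h1 h2
          rw [abs_sub_comm] at this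
          have e : - m' (i+1) - 1 - (- m' i - 1) = m' i - m' (i+1) := by ring
          rw [e]
          exact this)
        (fun (x : X) β k => x.1 β (-k)) (fun x => x.2.reflect)
        (fun i h1 h2 => by simpa only [e1] using (v1 i h1 h2).1)
        (fun i h1 h2 => by simpa only [e2] using (v0 i h1 h2).1)
        (fun i h1 h2 => by simpa only [e1] using (v1 i h1 h2).2)
        (fun i h1 h2 => by simpa only [e2] using (v0 i h1 h2).2) α hα1 hα2 (-n) (by omega)
      simpa only [neg_neg] using this
  obtain ⟨P, d, hP, h⟩ := main
  refine ⟨P, d, hP, fun R hp h0 ht hr => ?_⟩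
  exact h ⟨R, ⟨hp, h0, ht, hr⟩⟩
end
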